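/- Let n ≥ 1, let B be the open unit ball in ℝ^{2n}, and let u : ℝ^{2n} → ℝ be a smooth function whose restriction to B is non-constant. Then there exists a constant C > 0 (depending only on u) such that for every smooth f : ℝ^{2n} → ℝ whose support is a compact subset of B, with ∫ f dvol = 0 and ‖f‖_∞ ≤ 1, there exist a natural number N ≤ C and smooth diffeomorphisms Φ_{1,+}, Φ_{1,-}, …, Φ_{N,+}, Φ_{N,-} of ℝ^{2n}, each preserving Lebesgue measure and each equal to the identity outside some compact subset of B, such that f = ∑_{i=1}^N (u ∘ Φ_{i,+} − u ∘ Φ_{i,-}). In particular N depends only on u and not on f. -/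

import Mathlib

open MeasureTheory

/-- A smooth diffeomorphism of `ℝ^d` preserving Lebesgue measure and equal to the
identity outside some compact subset of the set `S`. -/
def IsVolDiffeoSuppIn (d : ℕ) (S : Set (EuclideanSpace ℝ (Fin d)))
    (Φ : EuclideanSpace ℝ (Fin d) → EuclideanSpace ℝ (Fin d)) : Prop :=
  ContDiff ℝ (⊤ : ℕ∞) Φ ∧
  (∃ Ψ : EuclideanSpace ℝ (Fin d) → EuclideanSpace ℝ (Fin d),
    ContDiff ℝ (⊤ : ℕ∞) Ψ ∧ Function.LeftInverse Ψ Φ ∧ Function.RightInverse Ψ Φ) ∧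
  MeasurePreserving Φ volume volume ∧
  (∃ K : Set (EuclideanSpace ℝ (Fin d)), IsCompact K ∧ K ⊆ S ∧ ∀ x ∉ K, Φ x = x)

namespace VolFlex

/-! ### Functions with small directional Lipschitz constant -/

section DirLip

variable {E : Type} [NormedAddCommGroup E] [NormedSpace ℝ E]

/-- `g` is `κ`-Lipschitz along every line with direction `v`. -/
def DirLip (κ : ℝ) (v : E) (g : E → ℝ) : Prop :=
  ∀ x (t : ℝ), |g (x + t • v) - g x| ≤ κ * |t|

theorem DirLip.mono {κ κ' : ℝ} {v : E} {g : E → ℝ} (h : DirLip κ v g) (hk : κ ≤ κ') :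
    DirLip κ' v g := fun x t =>
  (h x t).trans (mul_le_mul_of_nonneg_right hk (abs_nonneg t))

theorem DirLip.neg {κ : ℝ} {v : E} {g : E → ℝ} (h : DirLip κ v g) :
    DirLip κ v (fun x => -g x) := fun x t => by
  have := h x t
  rwa [← abs_neg, show -(-g (x + t • v) - -g x) = g (x + t • v) - g x by ring]

theorem DirLip.const_mul {κ : ℝ} {v : E} {g : E → ℝ} (h : DirLip κ v g) (c : ℝ) :
    DirLip (|c| * κ) v (fun x => c * g x) := fun x t => by
  rw [← mul_sub, abs_mul, mul_assoc]
  exact mul_le_mul_of_nonneg_left (h x t) (abs_nonneg c)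

theorem DirLip.comp_add_right {κ : ℝ} {v : E} {g : E → ℝ} (h : DirLip κ v g) (w : E) :
    DirLip κ v (fun x => g (x + w)) := fun x t => by
  have := h (x + w) t
  rwa [add_right_comm] at this

theorem DirLip.nonneg {κ : ℝ} {v : E} {g : E → ℝ} (h : DirLip κ v g) : 0 ≤ κ := by
  simpa using (abs_nonneg _).trans (h 0 1)

theorem hasDerivAt_line {g : E → ℝ} (hg : ContDiff ℝ (⊤ : ℕ∞) g) (x v : E) (t : ℝ) :
    HasDerivAt (fun s : ℝ => g (x + s • v)) (fderiv ℝ g (x + t • v) v) t := by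
  have h1 : HasDerivAt (fun s : ℝ => x + s • v) v t := by
    simpa using ((hasDerivAt_id t).smul_const v).const_add x
  exact ((hg.differentiable (by simp)) _).hasFDerivAt.comp_hasDerivAt t h1

theorem dirLip_of_fderiv_le {g : E → ℝ} (hg : ContDiff ℝ (⊤ : ℕ∞) g) {v : E} {κ : ℝ}
    (h : ∀ x, |fderiv ℝ g x v| ≤ κ) : DirLip κ v g := fun x t => by
  have := convex_univ.norm_image_sub_le_of_norm_hasDerivWithin_le (𝕜 := ℝ) (s := Set.univ)
    (f := fun s : ℝ => g (x + s • v)) (f' := fun s => fderiv ℝ g (x + s • v) v) (C := κ)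
    (fun s _ => (hasDerivAt_line hg x v s).hasDerivWithinAt)
    (fun s _ => h _) (Set.mem_univ (0 : ℝ)) (Set.mem_univ t)
  simpa using this

theorem DirLip.abs_fderiv_le {g : E → ℝ} (hg : ContDiff ℝ (⊤ : ℕ∞) g) {v : E} {κ : ℝ}
    (h : DirLip κ v g) (x : E) : |fderiv ℝ g x v| ≤ κ := by
  have h1 := hasDerivAt_line hg x v 0
  have h2 := h1.le_of_lip' h.nonneg (Filter.Eventually.of_forall fun t => by
    simpa using h x t)
  simpa using h2

/-- The transvection-like equivalence `w ↦ w + ℓ w • a`. -/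
noncomputable def transvectionEquiv (ℓ : E →L[ℝ] ℝ) (a : E) (h : 1 + ℓ a ≠ 0) : E ≃L[ℝ] E :=
  ContinuousLinearEquiv.equivOfInverse
    (ContinuousLinearMap.id ℝ E + ℓ.smulRight a)
    (ContinuousLinearMap.id ℝ E - (1 + ℓ a)⁻¹ • ℓ.smulRight a)
    (fun w => by
      simp only [add_apply, sub_apply, ContinuousLinearMap.id_apply,
        ContinuousLinearMap.smulRight_apply, smul_apply, map_add, map_smul]
      match_scalars <;> field_simp
      ring)
    (fun w => by
      simp only [add_apply, sub_apply, ContinuousLinearMap.id_apply,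
        ContinuousLinearMap.smulRight_apply, smul_apply, map_sub, map_smul]
      match_scalars <;> field_simp
      ring)

theorem hasFDerivAt_shift {g : E → ℝ} (hg : ContDiff ℝ (⊤ : ℕ∞) g) (a x : E) :
    HasFDerivAt (fun X => X + g X • a)
      (ContinuousLinearMap.id ℝ E + (fderiv ℝ g x).smulRight a) x :=
  (hasFDerivAt_id x).add
    (((hg.differentiable (by simp)) x).hasFDerivAt.smul_const a)

/-- Two functions `g`, `g'` such that `X ↦ X + g X • a` and `Y ↦ Y + g' Y • a` are mutually
inverse. -/
structure IsDual (a : E) (g g' : E → ℝ) : Prop where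
  left : ∀ X, g' (X + g X • a) = -g X
  right : ∀ Y, g (Y + g' Y • a) = -g' Y

theorem IsDual.symm {a : E} {g g' : E → ℝ} (h : IsDual a g g') : IsDual a g' g :=
  ⟨h.right, h.left⟩

theorem IsDual.leftInverse {a : E} {g g' : E → ℝ} (h : IsDual a g g') (X : E) :
    (X + g X • a) + g' (X + g X • a) • a = X := by
  rw [h.left]; simp

theorem IsDual.abs_sub_le {a : E} {g g' : E → ℝ} (h : IsDual a g g') {κ : ℝ}
    (hL : DirLip κ a g) (hκ : κ < 1) (Y v : E) :
    |g' (Y + v) - g' Y| ≤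
      |g (Y + g' Y • a + v) - g (Y + g' Y • a)| / (1 - κ) := by
  set D := g' (Y + v) - g' Y with hD
  have h1 := h.right Y
  have h2 := h.right (Y + v)
  have h3 : Y + v + g' (Y + v) • a = (Y + g' Y • a + v) + D • a := by
    rw [hD, sub_smul]; abel
  rw [h3] at h2
  have h4 := hL (Y + g' Y • a + v) D
  rw [h2] at h4
  rw [le_div_iff₀ (by linarith), h1]
  have h5 : |D| ≤ |-g' (Y + v) - g (Y + g' Y • a + v)|
      + |g (Y + g' Y • a + v) - -g' Y| := by
    rw [← abs_neg D]
    refine le_trans (le_of_eq ?_) (abs_add_le _ _)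
    congr 1; rw [hD]; ring
  linarith

theorem IsDual.dirLip {a : E} {g g' : E → ℝ} (h : IsDual a g g') {κ κ' : ℝ} {v : E}
    (hL : DirLip κ a g) (hκ : κ < 1) (hv : DirLip κ' v g) : DirLip (κ' / (1 - κ)) v g' :=
  fun Y t => by
    refine (h.abs_sub_le hL hκ Y (t • v)).trans ?_
    rw [div_mul_eq_mul_div]
    exact div_le_div_of_nonneg_right (hv _ t) (by linarith)

theorem IsDual.continuous {a : E} {g g' : E → ℝ} (h : IsDual a g g') {κ : ℝ}
    (hL : DirLip κ a g) (hκ : κ < 1) (hg : Continuous g) : Continuous g' := by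
  rw [continuous_iff_continuousAt]
  intro Y
  rw [ContinuousAt, tendsto_iff_dist_tendsto_zero]
  have h1 : Filter.Tendsto (fun Z => |g (Y + g' Y • a + (Z - Y)) - g (Y + g' Y • a)| / (1 - κ))
      (nhds Y) (nhds 0) := by
    have : Continuous (fun Z => |g (Y + g' Y • a + (Z - Y)) - g (Y + g' Y • a)| / (1 - κ)) := by
      fun_prop
    simpa using this.tendsto Y
  refine squeeze_zero (fun _ => dist_nonneg) (fun Z => ?_) h1
  have := h.abs_sub_le hL hκ Y (Z - Y)
  rwa [add_sub_cancel, ← Real.dist_eq] at this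

variable [CompleteSpace E]

theorem exists_isDual {g : E → ℝ} (hg : ContDiff ℝ (⊤ : ℕ∞) g) {a : E} {κ : ℝ} (hκ : κ < 1)
    (hL : DirLip κ a g) : ∃ g' : E → ℝ, ContDiff ℝ (⊤ : ℕ∞) g' ∧ IsDual a g g' := by
  have hfix : ∀ Y : E, ∃ s : ℝ, g (Y + s • a) = -s := by
    intro Y
    have hc : ContractingWith ⟨κ, hL.nonneg⟩ (fun s : ℝ => -g (Y + s • a)) := by
      refine ⟨by exact_mod_cast hκ, LipschitzWith.of_dist_le_mul fun s t => ?_⟩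
      have := hL (Y + s • a) (t - s)
      rw [add_assoc, ← add_smul, add_sub_cancel] at this
      rw [Real.dist_eq, Real.dist_eq, abs_sub_comm s t]
      change |_| ≤ κ * |t - s|
      simpa [neg_add_eq_sub] using this
    refine ⟨hc.fixedPoint, ?_⟩
    have h := hc.fixedPoint_isFixedPt
    rw [Function.IsFixedPt] at h
    linarith
  choose g' hg' using hfix
  have hd : IsDual a g g' := by
    refine ⟨fun X => ?_, hg'⟩
    have h1 := hg' (X + g X • a)
    rw [add_assoc, ← add_smul] at h1
    have h2 := hL X (g X + g' (X + g X • a))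
    rw [h1, ← abs_neg, show -(-g' (X + g X • a) - g X) = g X + g' (X + g X • a) by ring] at h2
    have h3 : |g X + g' (X + g X • a)| = 0 := by
      nlinarith [abs_nonneg (g X + g' (X + g X • a))]
    linarith [abs_eq_zero.1 h3]
  have hc' := hd.continuous hL hκ hg.continuous
  have hgc := hg.continuous
  let A : E ≃ₜ E :=
    { toFun := fun X => X + g X • a
      invFun := fun Y => Y + g' Y • a
      left_inv := hd.leftInverse
      right_inv := hd.symm.leftInverse
      continuous_toFun := by fun_prop
      continuous_invFun := by fun_prop }
  have hne : ∀ x, 1 + fderiv ℝ g x a ≠ 0 := fun x => by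
    have := abs_le.1 (hL.abs_fderiv_le hg x)
    linarith [this.1]
  have hs : ContDiff ℝ (⊤ : ℕ∞) A.symm :=
    A.contDiff_symm (f₀' := fun x => transvectionEquiv (fderiv ℝ g x) a (hne x))
      (fun x => hasFDerivAt_shift hg a x) (by
        change ContDiff ℝ (⊤ : ℕ∞) (fun X => X + g X • a)
        fun_prop)
  refine ⟨g', ?_, hd⟩
  have h2 : g' = fun Y => -g (A.symm Y) := by
    funext Y
    have := hd.right Y
    change g' Y = -g (Y + g' Y • a)
    linarith
  rw [h2]
  exact (hg.comp hs).neg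

end DirLip

/-! ### Volume preserving diffeomorphisms and representable functions -/

/-- `d`-dimensional Euclidean space. -/
abbrev Euc (d : ℕ) := EuclideanSpace ℝ (Fin d)

section Group

variable {d : ℕ} {U : Set (Euc d)}

theorem isVolDiffeo_id : IsVolDiffeoSuppIn d U id :=
  ⟨contDiff_id, ⟨id, contDiff_id, fun _ => rfl, fun _ => rfl⟩, MeasurePreserving.id _,
    ∅, isCompact_empty, Set.empty_subset _, fun _ _ => rfl⟩

theorem IsVolDiffeo.comp {Φ Θ : Euc d → Euc d} (h : IsVolDiffeoSuppIn d U Φ)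
    (h' : IsVolDiffeoSuppIn d U Θ) : IsVolDiffeoSuppIn d U (Φ ∘ Θ) := by
  obtain ⟨h1, ⟨Ψ, h2, h3, h4⟩, h5, K, h6, h7, h8⟩ := h
  obtain ⟨h1', ⟨Ψ', h2', h3', h4'⟩, h5', K', h6', h7', h8'⟩ := h'
  refine ⟨h1.comp h1', ⟨Ψ' ∘ Ψ, h2'.comp h2, h3.comp h3', h4.comp h4'⟩, h5.comp h5', K ∪ K',
    h6.union h6', Set.union_subset h7 h7', fun x hx => ?_⟩
  rw [Set.mem_union, not_or] at hx
  rw [Function.comp_apply, h8' x hx.2, h8 x hx.1]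

theorem IsVolDiffeo.exists_inverse {Φ : Euc d → Euc d} (h : IsVolDiffeoSuppIn d U Φ) :
    ∃ Ψ, IsVolDiffeoSuppIn d U Ψ ∧ Function.LeftInverse Ψ Φ ∧ Function.RightInverse Ψ Φ := by
  obtain ⟨h1, ⟨Ψ, h2, h3, h4⟩, h5, K, h6, h7, h8⟩ := h
  refine ⟨Ψ, ⟨h2, ⟨Φ, h1, h4, h3⟩, ?_, K, h6, h7, fun x hx => ?_⟩, h3, h4⟩
  · let e : Euc d ≃ᵐ Euc d :=
      { toFun := Φ
        invFun := Ψ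
        left_inv := h3
        right_inv := h4
        measurable_toFun := h1.continuous.measurable
        measurable_invFun := h2.continuous.measurable }
    exact MeasurePreserving.symm e h5
  · conv_lhs => rw [← h8 x hx]
    exact h3 x

theorem IsVolDiffeo.iterate {Φ : Euc d → Euc d} (h : IsVolDiffeoSuppIn d U Φ) (m : ℕ) :
    IsVolDiffeoSuppIn d U (Φ^[m]) := by
  induction m with
  | zero => exact isVolDiffeo_id
  | succ m ih => exact IsVolDiffeo.comp ih h

variable (U) in
/-- `f` is a sum of `N` differences of compositions of `u` with volume preserving
diffeomorphisms supported in `U`. -/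
def Rep (u : Euc d → ℝ) (N : ℕ) (f : Euc d → ℝ) : Prop :=
  ∃ Φp Φm : Fin N → (Euc d → Euc d), (∀ i, IsVolDiffeoSuppIn d U (Φp i)) ∧
    (∀ i, IsVolDiffeoSuppIn d U (Φm i)) ∧ f = fun x => ∑ i, (u (Φp i x) - u (Φm i x))

variable {u v f g : Euc d → ℝ} {M N : ℕ}

theorem rep_zero (N : ℕ) : Rep U u N (fun _ => 0) :=
  ⟨fun _ => id, fun _ => id, fun _ => isVolDiffeo_id, fun _ => isVolDiffeo_id, by simp⟩

theorem rep_of_comp_sub {Φ Θ : Euc d → Euc d} (h : IsVolDiffeoSuppIn d U Φ)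
    (h' : IsVolDiffeoSuppIn d U Θ) : Rep U u 1 (fun x => u (Φ x) - u (Θ x)) :=
  ⟨fun _ => Φ, fun _ => Θ, fun _ => h, fun _ => h', by simp⟩

theorem Rep.add (hf : Rep U u N f) (hg : Rep U u M g) : Rep U u (N + M) (fun x => f x + g x) := by
  obtain ⟨Φp, Φm, h1, h2, rfl⟩ := hf
  obtain ⟨Φp', Φm', h1', h2', rfl⟩ := hg
  refine ⟨Fin.append Φp Φp', Fin.append Φm Φm', fun i => ?_, fun i => ?_, ?_⟩
  · refine Fin.addCases (fun i => ?_) (fun i => ?_) i <;> simp [h1, h1']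
  · refine Fin.addCases (fun i => ?_) (fun i => ?_) i <;> simp [h2, h2']
  · funext x
    simp [Fin.sum_univ_add]
    ring

theorem Rep.neg (hf : Rep U u N f) : Rep U u N (fun x => -f x) := by
  obtain ⟨Φp, Φm, h1, h2, rfl⟩ := hf
  exact ⟨Φm, Φp, h2, h1, by funext x; simp⟩

theorem Rep.sub (hf : Rep U u N f) (hg : Rep U u M g) :
    Rep U u (N + M) (fun x => f x - g x) := by
  simpa [sub_eq_add_neg] using hf.add hg.neg

theorem Rep.mono (hf : Rep U u N f) (h : N ≤ M) : Rep U u M f := by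
  obtain ⟨k, rfl⟩ := Nat.exists_eq_add_of_le h
  simpa using hf.add (rep_zero k)

theorem Rep.comp (hf : Rep U u N f) {Φ : Euc d → Euc d} (h : IsVolDiffeoSuppIn d U Φ) :
    Rep U u N (fun x => f (Φ x)) := by
  obtain ⟨Φp, Φm, h1, h2, rfl⟩ := hf
  exact ⟨fun i => Φp i ∘ Φ, fun i => Φm i ∘ Φ, fun i => IsVolDiffeo.comp (h1 i) h,
    fun i => IsVolDiffeo.comp (h2 i) h, rfl⟩

theorem Rep.sum {ι : Type*} (s : Finset ι) {F : ι → Euc d → ℝ} {n : ι → ℕ}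
    (h : ∀ i ∈ s, Rep U u (n i) (F i)) : Rep U u (∑ i ∈ s, n i) (fun x => ∑ i ∈ s, F i x) := by
  classical
  induction s using Finset.induction_on with
  | empty => simpa using rep_zero 0
  | insert a s ha ih =>
    simp only [Finset.sum_insert ha]
    exact (h a (by simp)).add (ih fun i hi => h i (by simp [hi]))

theorem Rep.trans (hv : Rep U u M v) (hf : Rep U v N f) : Rep U u (N * (M + M)) f := by
  obtain ⟨Φp, Φm, h1, h2, rfl⟩ := hf
  simpa using Rep.sum Finset.univ (n := fun _ => M + M)
    (F := fun i x => v (Φp i x) - v (Φm i x)) fun i _ => (hv.comp (h1 i)).sub (hv.comp (h2 i))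

theorem Rep.of_comp {Θ : Euc d → Euc d} (h : IsVolDiffeoSuppIn d U Θ)
    (hf : Rep U (fun x => u (Θ x)) N f) : Rep U u N f := by
  obtain ⟨Φp, Φm, h1, h2, rfl⟩ := hf
  exact ⟨fun i => Θ ∘ Φp i, fun i => Θ ∘ Φm i, fun i => IsVolDiffeo.comp h (h1 i),
    fun i => IsVolDiffeo.comp h (h2 i), rfl⟩

end Group

/-! ### Diffeomorphisms defined by generating functions -/

section Generating

theorem det_id_add_smulRight {E : Type} [NormedAddCommGroup E] [NormedSpace ℝ E]
    [FiniteDimensional ℝ E] (ℓ : E →L[ℝ] ℝ) (a : E) :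
    (ContinuousLinearMap.id ℝ E + ℓ.smulRight a).det = 1 + ℓ a := by
  have := LinearMap.transvection.det (ℓ : E →ₗ[ℝ] ℝ) a
  rw [ContinuousLinearMap.det]
  exact this

variable {d : ℕ}

/-- The directional derivative of `S` in the direction `b`. -/
noncomputable def pd (S : Euc d → ℝ) (b : Euc d) : Euc d → ℝ := fun x => fderiv ℝ S x b

theorem contDiff_pd {S : Euc d → ℝ} (hS : ContDiff ℝ (⊤ : ℕ∞) S) (b : Euc d) :
    ContDiff ℝ (⊤ : ℕ∞) (pd S b) :=
  (hS.fderiv_right (m := (⊤ : ℕ∞)) (by simp)).clm_apply contDiff_const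

theorem fderiv_pd {S : Euc d → ℝ} (hS : ContDiff ℝ (⊤ : ℕ∞) S) (x a b : Euc d) :
    fderiv ℝ (pd S b) x a = fderiv ℝ (fderiv ℝ S) x a b := by
  have h : DifferentiableAt ℝ (fderiv ℝ S) x :=
    (hS.fderiv_right (m := (⊤ : ℕ∞)) (by simp)).differentiable (by simp) x
  change fderiv ℝ (fun y => fderiv ℝ S y b) x a = _
  rw [fderiv_clm_apply h (differentiableAt_const b)]
  simp

theorem pd_comm {S : Euc d → ℝ} (hS : ContDiff ℝ (⊤ : ℕ∞) S) (x a b : Euc d) :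
    fderiv ℝ (pd S b) x a = fderiv ℝ (pd S a) x b := by
  rw [fderiv_pd hS, fderiv_pd hS]
  exact (hS.contDiffAt.isSymmSndFDerivAt
    (by
      simp only [minSmoothness_of_isRCLikeNormedField]
      exact WithTop.coe_le_coe.2 (le_top (a := (2 : ℕ∞))))).eq a b

theorem pd_eq_zero {S : Euc d → ℝ} {K : Set (Euc d)} (hK : IsClosed K) (h0 : ∀ x ∉ K, S x = 0)
    (b x : Euc d) (hx : x ∉ K) : pd S b x = 0 := by
  have : S =ᶠ[nhds x] fun _ => 0 := by
    filter_upwards [hK.isOpen_compl.mem_nhds hx] with y hy using h0 y hy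
  rw [pd, this.fderiv_eq]
  simp

theorem IsDual.volume_image {a : Euc d} {g g' : Euc d → ℝ} (hg : ContDiff ℝ (⊤ : ℕ∞) g)
    (h : IsDual a g g') {t : Set (Euc d)} (ht : MeasurableSet t) :
    ∫⁻ x in t, ENNReal.ofReal |1 + fderiv ℝ g x a| = volume ((fun X => X + g X • a) '' t) := by
  rw [← lintegral_abs_det_fderiv_eq_addHaar_image volume ht
    (fun x _ => (hasFDerivAt_shift hg a x).hasFDerivWithinAt)
    (Function.LeftInverse.injective (g := fun Y => Y + g' Y • a) h.leftInverse).injOn]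
  simp_rw [det_id_add_smulRight]

/-- The diffeomorphism with generating function `S`, with respect to the directions `a`, `b`. -/
theorem exists_generated {U K : Set (Euc d)} (hK : IsCompact K) (hKU : K ⊆ U) {S : Euc d → ℝ}
    (hS : ContDiff ℝ (⊤ : ℕ∞) S) (h0 : ∀ x ∉ K, S x = 0) {a b : Euc d}
    (hL : DirLip (1 / 2) a (pd S b)) :
    ∃ Φ, IsVolDiffeoSuppIn d U Φ ∧ ∀ X, Φ (X + pd S b X • a) = X + pd S a X • b := by
  have hLb : DirLip (1 / 2) b (pd S a) := dirLip_of_fderiv_le (contDiff_pd hS a) fun x => by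
    rw [pd_comm hS]
    exact hL.abs_fderiv_le (contDiff_pd hS b) x
  have hb := contDiff_pd hS b
  have ha := contDiff_pd hS a
  obtain ⟨g, hg, hgd⟩ := exists_isDual hb (by norm_num) hL
  obtain ⟨k, hk, hkd⟩ := exists_isDual ha (by norm_num) hLb
  let A : Euc d → Euc d := fun X => X + pd S b X • a
  let A' : Euc d → Euc d := fun X => X + g X • a
  let B : Euc d → Euc d := fun X => X + pd S a X • b
  let B' : Euc d → Euc d := fun X => X + k X • b
  have hAs : ContDiff ℝ (⊤ : ℕ∞) A := contDiff_id.add (hb.smul contDiff_const)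
  have hBs : ContDiff ℝ (⊤ : ℕ∞) B := contDiff_id.add (ha.smul contDiff_const)
  have hAs' : ContDiff ℝ (⊤ : ℕ∞) A' := contDiff_id.add (hg.smul contDiff_const)
  have hBs' : ContDiff ℝ (⊤ : ℕ∞) B' := contDiff_id.add (hk.smul contDiff_const)
  have hA1 : Function.LeftInverse A' A := hgd.leftInverse
  have hA2 : Function.LeftInverse A A' := hgd.symm.leftInverse
  have hB1 : Function.LeftInverse B' B := hkd.leftInverse
  have hB2 : Function.LeftInverse B B' := hkd.symm.leftInverse
  have hl : Function.LeftInverse (A ∘ B') (B ∘ A') := fun x => by simp [hB1 _, hA2 _]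
  have hr : Function.RightInverse (A ∘ B') (B ∘ A') := fun x => by simp [hA1 _, hB2 _]
  refine ⟨B ∘ A', ⟨hBs.comp hAs', ⟨A ∘ B', hAs.comp hBs', hl, hr⟩,
    ⟨(hBs.comp hAs').continuous.measurable, ?_⟩, K, hK, hKU, fun x hx => ?_⟩, fun X => ?_⟩
  · refine Measure.ext fun s hs => ?_
    have hm := (hBs.comp hAs').continuous.measurable
    rw [Measure.map_apply hm hs]
    have ht : MeasurableSet (B ⁻¹' s) := hBs.continuous.measurable hs
    have h1 := hgd.volume_image hb ht
    have h2 := hkd.volume_image ha ht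
    simp_rw [pd_comm hS _ b a] at h2
    rw [h1] at h2
    have h3 : (A '' (B ⁻¹' s)) = (B ∘ A') ⁻¹' s := by
      rw [Set.image_eq_preimage_of_inverse hA1 hA2]; rfl
    have h4 : (B '' (B ⁻¹' s)) = s := Set.image_preimage_eq s hB2.surjective
    change volume (A '' _) = volume (B '' _) at h2
    rw [← h3, h2, h4]
  · have h1 : A x = x := by
      change x + _ • a = x
      rw [pd_eq_zero hK.isClosed h0 b x hx]; simp
    have h2 : A' x = x := by
      conv_lhs => rw [← h1]
      exact hA1 x
    change B (A' x) = x
    rw [h2]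
    change x + _ • b = x
    rw [pd_eq_zero hK.isClosed h0 a x hx]; simp
  · change B (A' (A X)) = B X
    rw [hA1]

end Generating

/-! ### Integration along lines -/

section LineInt

variable {E : Type} [NormedAddCommGroup E] [NormedSpace ℝ E]

/-- A smooth function vanishing outside `K`. -/
structure SmoothIn {F : Type} [NormedAddCommGroup F] [NormedSpace ℝ F] (K : Set E) (g : E → F) :
    Prop where
  smooth : ContDiff ℝ (⊤ : ℕ∞) g
  eq_zero : ∀ x ∉ K, g x = 0

variable {F : Type} [NormedAddCommGroup F] [NormedSpace ℝ F] {K : Set E} {g : E → F}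

theorem SmoothIn.mono {K' : Set E} (h : SmoothIn K g) (hK : K ⊆ K') : SmoothIn K' g :=
  ⟨h.smooth, fun x hx => h.eq_zero x fun h' => hx (hK h')⟩

theorem SmoothIn.neg (h : SmoothIn K g) : SmoothIn K (fun x => -g x) :=
  ⟨h.smooth.neg, fun x hx => by rw [h.eq_zero x hx, neg_zero]⟩

theorem SmoothIn.add {g' : E → F} (h : SmoothIn K g) (h' : SmoothIn K g') :
    SmoothIn K (fun x => g x + g' x) :=
  ⟨h.smooth.add h'.smooth, fun x hx => by rw [h.eq_zero x hx, h'.eq_zero x hx, add_zero]⟩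

theorem SmoothIn.hasCompactSupport (h : SmoothIn K g) (hK : IsCompact K) : HasCompactSupport g :=
  HasCompactSupport.intro hK h.eq_zero

theorem SmoothIn.exists_bound (h : SmoothIn K g) (hK : IsCompact K) :
    ∃ C, 0 ≤ C ∧ ∀ x, ‖g x‖ ≤ C := by
  obtain ⟨C, hC⟩ := (h.hasCompactSupport hK).exists_bound_of_continuous h.smooth.continuous
  exact ⟨C, (norm_nonneg _).trans (hC 0), hC⟩

theorem SmoothIn.fderiv (h : SmoothIn K g) (hK : IsClosed K) : SmoothIn K (fderiv ℝ g) := by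
  refine ⟨h.smooth.fderiv_right (by simp), fun x hx => ?_⟩
  have : g =ᶠ[nhds x] fun _ => 0 := by
    filter_upwards [hK.isOpen_compl.mem_nhds hx] with y hy using h.eq_zero y hy
  rw [this.fderiv_eq]
  simp

theorem exists_time_bound (hK : IsCompact K) {e : E} (he : e ≠ 0) (x : E) :
    ∃ T : ℝ, ∀ y ∈ Metric.ball x 1, ∀ t : ℝ, y + t • e ∈ K → t ∈ Set.Icc (-T) T := by
  obtain ⟨R, hR⟩ := hK.isBounded.subset_closedBall (0 : E)
  refine ⟨(R + ‖x‖ + 1) / ‖e‖, fun y hy t ht => ?_⟩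
  rw [Set.mem_Icc, ← abs_le, le_div_iff₀ (norm_pos_iff.2 he), ← Real.norm_eq_abs, ← norm_smul]
  have h1 := hR ht
  rw [mem_closedBall_zero_iff] at h1
  rw [Metric.mem_ball, dist_eq_norm] at hy
  have h2 : ‖t • e‖ ≤ ‖y + t • e‖ + ‖x‖ + ‖y - x‖ := by
    calc ‖t • e‖ = ‖(y + t • e) - x - (y - x)‖ := by congr 1; abel
      _ ≤ ‖(y + t • e) - x‖ + ‖y - x‖ := norm_sub_le _ _
      _ ≤ _ := by gcongr; exact norm_sub_le _ _
  linarith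

theorem hasCompactSupport_line (h : SmoothIn K g) (hK : IsCompact K) {e : E} (he : e ≠ 0) (x : E) :
    HasCompactSupport (fun t : ℝ => g (x + t • e)) := by
  obtain ⟨T, hT⟩ := exists_time_bound hK he x
  refine HasCompactSupport.intro (isCompact_Icc (a := -T) (b := T)) fun t ht => ?_
  exact h.eq_zero _ fun hm => ht (hT x (Metric.mem_ball_self one_pos) t hm)

theorem continuous_line (h : SmoothIn K g) (e x : E) : Continuous (fun t : ℝ => g (x + t • e)) :=
  h.smooth.continuous.comp (by fun_prop)

theorem integrable_line (h : SmoothIn K g) (hK : IsCompact K) {e : E} (he : e ≠ 0) (x : E)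
    (μ : Measure ℝ) [IsLocallyFiniteMeasure μ] : Integrable (fun t : ℝ => g (x + t • e)) μ :=
  (continuous_line h e x).integrable_of_hasCompactSupport (hasCompactSupport_line h hK he x)

/-- The integral of `g` along the line through `x` with direction `e`. -/
noncomputable def lineInt (μ : Measure ℝ) (e : E) (g : E → F) (x : E) : F :=
  ∫ t, g (x + t • e) ∂μ

theorem hasFDerivAt_lineInt (h : SmoothIn K g) (hK : IsCompact K) {e : E} (he : e ≠ 0)
    (μ : Measure ℝ) [IsLocallyFiniteMeasure μ] (x : E) :
    HasFDerivAt (lineInt μ e g) (lineInt μ e (fderiv ℝ g) x) x := by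
  have h' := h.fderiv hK.isClosed
  obtain ⟨C, hC0, hC⟩ := h'.exists_bound hK
  obtain ⟨T, hT⟩ := exists_time_bound hK he x
  refine hasFDerivAt_integral_of_dominated_of_fderiv_le (Metric.ball_mem_nhds x one_pos)
    (F' := fun y t => fderiv ℝ g (y + t • e)) (bound := (Set.Icc (-T) T).indicator fun _ => C)
    (Filter.Eventually.of_forall fun y => (integrable_line h hK he y μ).aestronglyMeasurable)
    (integrable_line h hK he x μ) (integrable_line h' hK he x μ).aestronglyMeasurable
    (Filter.Eventually.of_forall fun t y hy => ?_) ?_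
    (Filter.Eventually.of_forall fun t y _ => ?_)
  · by_cases ht : t ∈ Set.Icc (-T) T
    · rw [Set.indicator_of_mem ht]; exact hC _
    · rw [Set.indicator_of_notMem ht, h'.eq_zero _ fun hm => ht (hT y hy t hm), norm_zero]
  · rw [integrable_indicator_iff measurableSet_Icc]
    exact integrableOn_const isCompact_Icc.measure_lt_top.ne
  · have h1 : HasFDerivAt (fun y : E => y + t • e) (ContinuousLinearMap.id ℝ E) y :=
      (hasFDerivAt_id y).add_const _
    simpa [Function.comp_def] using
      ((h.smooth.differentiable (by simp)) (y + t • e)).hasFDerivAt.comp y h1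

theorem contDiff_lineInt (h : SmoothIn K g) (hK : IsCompact K) {e : E} (he : e ≠ 0)
    (μ : Measure ℝ) [IsLocallyFiniteMeasure μ] : ContDiff ℝ (⊤ : ℕ∞) (lineInt μ e g) := by
  refine contDiff_infty.2 fun n => ?_
  induction n generalizing F with
  | zero =>
    exact contDiff_zero.2 (continuous_iff_continuousAt.2 fun x =>
      (hasFDerivAt_lineInt h hK he μ x).continuousAt)
  | succ n ih =>
    exact contDiff_succ_iff_hasFDerivAt.2 ⟨_, ih (h.fderiv hK.isClosed),
      hasFDerivAt_lineInt h hK he μ⟩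

end LineInt

section LineIntEuc

variable {d : ℕ} {K : Set (Euc d)} {g : Euc d → ℝ}

theorem SmoothIn.pd (h : SmoothIn K g) (hK : IsClosed K) (b : Euc d) : SmoothIn K (pd g b) :=
  ⟨contDiff_pd h.smooth b, fun x hx => pd_eq_zero hK h.eq_zero b x hx⟩

theorem pd_lineInt (h : SmoothIn K g) (hK : IsCompact K) {e : Euc d} (he : e ≠ 0)
    (μ : Measure ℝ) [IsLocallyFiniteMeasure μ] (b x : Euc d) :
    pd (lineInt μ e g) b x = lineInt μ e (pd g b) x := by
  rw [pd, (hasFDerivAt_lineInt h hK he μ x).fderiv, lineInt,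
    ContinuousLinearMap.integral_apply (integrable_line (h.fderiv hK.isClosed) hK he x μ)]
  rfl

theorem lineInt_pd_self (h : SmoothIn K g) (hK : IsCompact K) {e : Euc d} (he : e ≠ 0)
    (x : Euc d) : lineInt volume e (pd g e) x = 0 :=
  integral_eq_zero_of_hasDerivAt_of_integrable (fun t => hasDerivAt_line h.smooth x e t)
    (integrable_line (h.pd hK.isClosed e) hK he x _) (integrable_line h hK he x _)

theorem lineInt_Iic_pd_self (h : SmoothIn K g) (hK : IsCompact K) {e : Euc d} (he : e ≠ 0)
    (x : Euc d) : lineInt (volume.restrict (Set.Iic 0)) e (pd g e) x = g x := by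
  have hs : ContDiff ℝ 1 (fun t : ℝ => g (x + t • e)) :=
    (h.smooth.comp (by fun_prop : ContDiff ℝ (⊤ : ℕ∞) fun t : ℝ => x + t • e)).of_le
      (by exact_mod_cast le_top)
  have h1 := HasCompactSupport.integral_Iic_deriv_eq hs (hasCompactSupport_line h hK he x) 0
  rw [lineInt]
  simp only [zero_smul, add_zero] at h1
  rw [← h1]
  congr 1
  funext t
  exact (hasDerivAt_line h.smooth x e t).deriv.symm

/-- A smooth function supported in a compact convex set whose integrals over lines with direction
`e` vanish is the `e`-derivative of such a function. -/
theorem exists_primitive (h : SmoothIn K g) (hK : IsCompact K) (hc : Convex ℝ K) {e : Euc d}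
    (he : e ≠ 0) (h0 : ∀ x, lineInt volume e g x = 0) :
    ∃ R, SmoothIn K R ∧ ∀ x, pd R e x = g x := by
  refine ⟨lineInt (volume.restrict (Set.Iic 0)) e g, ⟨contDiff_lineInt h hK he _, fun x hx => ?_⟩,
    fun x => ?_⟩
  · by_cases h1 : ∀ t : ℝ, t ≤ 0 → x + t • e ∉ K
    · exact setIntegral_eq_zero_of_forall_eq_zero fun t ht => h.eq_zero _ (h1 t ht)
    · push Not at h1
      obtain ⟨s, hs, hsK⟩ := h1
      have h2 : ∀ t : ℝ, 0 ≤ t → x + t • e ∉ K := fun t ht htK => hx (by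
        rcases ht.eq_or_lt with rfl | ht
        · simpa using htK
        have hts : 0 < t - s := by linarith
        have := hc hsK htK (a := t / (t - s)) (b := -s / (t - s)) (by positivity)
          (div_nonneg (by linarith) hts.le) (by field_simp; ring)
        convert this using 1
        have h3 : t - s ≠ 0 := hts.ne'
        match_scalars <;> field_simp <;> ring)
      have h3 := h0 x
      rw [lineInt, ← setIntegral_eq_integral_of_forall_compl_eq_zero (s := Set.Iic 0)] at h3
      · exact h3
      · intro t ht
        exact h.eq_zero _ (h2 t (not_le.1 ht).le)
  · rw [pd_lineInt h hK he, lineInt_Iic_pd_self h hK he]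

theorem integral_pd_eq_zero (h : SmoothIn K g) (hK : IsCompact K) (e : Euc d) :
    ∫ x, pd g e x = 0 := by
  have h1 := integral_mul_fderiv_eq_neg_fderiv_mul_of_integrable (μ := (volume : Measure (Euc d)))
    (f := fun _ => (1 : ℝ)) (g := g) (v := e)
  simp only [fderiv_fun_const, Pi.zero_apply, zero_apply, zero_mul, integral_zero, neg_zero,
    one_mul] at h1
  refine h1 (integrable_zero _ _ _) ?_ ?_ (by fun_prop) fun x _ =>
    h.smooth.differentiable (by simp) x
  · exact (contDiff_pd h.smooth e).continuous.integrable_of_hasCompactSupport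
      ((h.pd hK.isClosed e).hasCompactSupport hK)
  · exact h.smooth.continuous.integrable_of_hasCompactSupport (h.hasCompactSupport hK)

end LineIntEuc

/-! ### Tilted functions -/

section Dual

variable {E : Type} [NormedAddCommGroup E] [NormedSpace ℝ E] {K : Set E} {a : E}
  {g g' g₁ g₂ g₁' g₂' : E → ℝ}

theorem exists_isDual_smoothIn [CompleteSpace E] {κ : ℝ} (hg : SmoothIn K g) (hκ : κ ≤ 1 / 2)
    (hL : DirLip κ a g) : ∃ g', SmoothIn K g' ∧ IsDual a g g' ∧
      (∀ v κ', DirLip κ' v g → DirLip (2 * κ') v g') ∧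
      ∀ C, (∀ x, |g x| ≤ C) → ∀ x, |g' x| ≤ C := by
  obtain ⟨g', hs, hd⟩ := exists_isDual hg.smooth (by linarith) hL
  refine ⟨g', ⟨hs, fun x hx => ?_⟩, hd, fun v κ' hv => ?_, fun C hC x => ?_⟩
  · have := hd.left x
    rwa [hg.eq_zero x hx, zero_smul, add_zero, neg_zero] at this
  · refine (hd.dirLip hL (by linarith) hv).mono ?_
    have := hv.nonneg
    rw [div_le_iff₀ (by linarith)]
    nlinarith
  · have := hd.right x
    rw [← abs_neg, ← this]
    exact hC _

/-- On every line with direction `a`, at least one of `g₁`, `g₂` vanishes. -/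
def LineDisjoint (a : E) (g₁ g₂ : E → ℝ) : Prop := ∀ x (t : ℝ), g₁ x = 0 ∨ g₂ (x + t • a) = 0

theorem LineDisjoint.symm (h : LineDisjoint a g₁ g₂) : LineDisjoint a g₂ g₁ := fun x t => by
  have := h (x + t • a) (-t)
  rw [neg_smul, add_neg_cancel_right] at this
  exact this.symm

theorem LineDisjoint.dual (h : LineDisjoint a g₁ g₂) (h₁ : IsDual a g₁ g₁')
    (h₂ : IsDual a g₂ g₂') : LineDisjoint a g₁' g₂' := fun x t => by
  by_cases hx : g₁' x = 0
  · exact Or.inl hx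
  · right
    have h3 := h₁.right x
    have h4 := h₂.right (x + t • a)
    have h5 := (h (x + g₁' x • a) (t - g₁' x + g₂' (x + t • a))).resolve_left
      (by rw [h3]; simpa using hx)
    have h6 : x + g₁' x • a + (t - g₁' x + g₂' (x + t • a)) • a
        = x + t • a + g₂' (x + t • a) • a := by module
    rw [h6, h4] at h5
    simpa using h5

theorem LineDisjoint.add_left_aux (h : LineDisjoint a g₁ g₂) (h₁ : IsDual a g₁ g₁')
    (h₂ : IsDual a g₂ g₂') (X : E) :
    g₁' (X + (g₁ X + g₂ X) • a) + g₂' (X + (g₁ X + g₂ X) • a) = -(g₁ X + g₂ X) := by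
  have key : ∀ {g₁ g₂ g₁' g₂' : E → ℝ}, LineDisjoint a g₁ g₂ → IsDual a g₁ g₁' →
      IsDual a g₂ g₂' → g₁ X ≠ 0 →
      g₁' (X + (g₁ X + g₂ X) • a) + g₂' (X + (g₁ X + g₂ X) • a) = -(g₁ X + g₂ X) := by
    intro g₁ g₂ g₁' g₂' h h₁ h₂ hX
    have h3 : g₂ X = 0 := by simpa using (h X 0).resolve_left hX
    have h5 := h₂.right (X + g₁ X • a)
    have h6 := (h X (g₁ X + g₂' (X + g₁ X • a))).resolve_left hX
    rw [add_smul, ← add_assoc, h5] at h6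
    rw [h3, add_zero, h₁.left X]
    linarith
  by_cases hX : g₁ X = 0
  · by_cases hX' : g₂ X = 0
    · have h3 := h₁.left X
      have h4 := h₂.left X
      simp only [hX, hX', zero_smul, add_zero, neg_zero] at h3 h4 ⊢
      linarith
    · have := key h.symm h₂ h₁ hX'
      rw [add_comm (g₁ X), add_comm (g₁' _)]
      exact this
  · exact key h h₁ h₂ hX

theorem LineDisjoint.isDual_add (h : LineDisjoint a g₁ g₂) (h₁ : IsDual a g₁ g₁')
    (h₂ : IsDual a g₂ g₂') : IsDual a (fun x => g₁ x + g₂ x) (fun x => g₁' x + g₂' x) :=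
  ⟨h.add_left_aux h₁ h₂, (h.dual h₁ h₂).add_left_aux h₁.symm h₂.symm⟩

theorem LineDisjoint.dirLip_add (h : LineDisjoint a g₁ g₂) {κ : ℝ} (h₁ : DirLip κ a g₁)
    (h₂ : DirLip κ a g₂) : DirLip κ a (fun x => g₁ x + g₂ x) := fun x t => by
  by_cases hx : ∃ s : ℝ, g₁ (x + s • a) ≠ 0
  · obtain ⟨s, hs⟩ := hx
    have h3 : ∀ t : ℝ, g₂ (x + t • a) = 0 := fun t => by
      have := (h (x + s • a) (t - s)).resolve_left hs
      rwa [add_assoc, ← add_smul, add_sub_cancel] at this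
    have h4 := h3 0
    rw [zero_smul, add_zero] at h4
    change |g₁ (x + t • a) + g₂ (x + t • a) - (g₁ x + g₂ x)| ≤ κ * |t|
    rw [h3, h4, add_zero, add_zero]
    exact h₁ x t
  · push Not at hx
    have h4 := hx 0
    rw [zero_smul, add_zero] at h4
    change |g₁ (x + t • a) + g₂ (x + t • a) - (g₁ x + g₂ x)| ≤ κ * |t|
    rw [hx, h4, zero_add, zero_add]
    exact h₂ x t

/-- `F` is the `l`-fold multiple of `q`, transported by the shift `X ↦ X - q X • a`. -/
def IsTilt (a : E) (l : ℝ) (q F : E → ℝ) : Prop :=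
  ∃ g', IsDual a (fun x => -q x) g' ∧ F = fun x => l * g' x

theorem exists_tilt [CompleteSpace E] {κ : ℝ} {q : E → ℝ} (hq : SmoothIn K q) (hκ : κ ≤ 1 / 2)
    (hL : DirLip κ a q) (l : ℝ) : ∃ F, IsTilt a l q F ∧ SmoothIn K F ∧
      (∀ v κ', DirLip κ' v q → DirLip (|l| * (2 * κ')) v F) ∧
      ∀ C, (∀ x, |q x| ≤ C) → ∀ x, |F x| ≤ |l| * C := by
  obtain ⟨g', h1, h2, h3, h4⟩ := exists_isDual_smoothIn hq.neg hκ hL.neg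
  refine ⟨fun x => l * g' x, ⟨g', h2, rfl⟩, ⟨contDiff_const.mul h1.smooth, fun x hx => ?_⟩,
    fun v κ' hv => (h3 v κ' hv.neg).const_mul l, fun C hC x => ?_⟩
  · rw [h1.eq_zero x hx, mul_zero]
  · rw [abs_mul]
    exact mul_le_mul_of_nonneg_left (h4 C (by simpa using hC) x) (abs_nonneg l)

theorem exists_untilt [CompleteSpace E] {κ : ℝ} {G : E → ℝ} (hG : SmoothIn K G) (hκ : κ ≤ 1 / 2)
    (hL : DirLip κ a G) (l : ℝ) : ∃ q, IsTilt a l q (fun x => l * G x) ∧ SmoothIn K q ∧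
      (∀ v κ', DirLip κ' v G → DirLip (2 * κ') v q) ∧
      (∀ C, (∀ x, |G x| ≤ C) → ∀ x, |q x| ≤ C) ∧ ∀ x, G (x - q x • a) = q x := by
  obtain ⟨g', h1, h2, h3, h4⟩ := exists_isDual_smoothIn hG hκ hL
  refine ⟨fun x => -g' x, ⟨G, by simpa using h2.symm, rfl⟩, h1.neg,
    fun v κ' hv => (h3 v κ' hv).neg, fun C hC x => ?_, fun x => ?_⟩
  · rw [abs_neg]
    exact h4 C hC x
  · have := h2.right x
    rwa [neg_smul, sub_neg_eq_add]

end Dual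

section ZeroLines

variable {d : ℕ} {U K : Set (Euc d)} {a b : Euc d} {q q₁ q₂ F F₁ F₂ u : Euc d → ℝ} {l : ℝ}
  {w : ℝ → ℝ} {ℓ : Euc d →L[ℝ] ℝ}

theorem IsTilt.integral_eq (hK : IsCompact K) (h : IsTilt a l q F) (hq : SmoothIn K q) {κ : ℝ}
    (hκ : κ < 1) (hL : DirLip κ a q) : ∫ x, F x = l * ∫ x, q x := by
  obtain ⟨g', hd, rfl⟩ := h
  rw [integral_const_mul]
  congr 1
  have hq' := hq.neg.smooth
  have h1 := integral_image_eq_integral_abs_det_fderiv_smul (volume : Measure (Euc d))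
    MeasurableSet.univ (fun x _ => (hasFDerivAt_shift hq' a x).hasFDerivWithinAt)
    (Function.LeftInverse.injective (g := fun Y => Y + g' Y • a) hd.leftInverse).injOn g'
  have h2 : (fun X => X + -q X • a) '' Set.univ = Set.univ :=
    Set.image_univ_of_surjective (Function.LeftInverse.surjective
      (g := fun Y => Y + g' Y • a) hd.symm.leftInverse)
  rw [h2] at h1
  simp only [Measure.restrict_univ, det_id_add_smulRight] at h1
  rw [h1]
  have h3 : ∀ x, |1 + fderiv ℝ (fun x => -q x) x a| • g' (x + -q x • a)
      = q x - (1 / 2) * pd (fun x => q x * q x) a x := fun x => by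
    have h4 := hd.left x
    have h5 := hL.abs_fderiv_le hq.smooth x
    have hdq := hq.smooth.differentiable (by simp) x
    rw [neg_smul] at h4 ⊢
    rw [h4, pd, fderiv_fun_mul hdq hdq, fderiv_fun_neg]
    simp only [neg_neg, neg_apply, add_apply, smul_apply, smul_eq_mul]
    rw [abs_of_nonneg (by linarith [(abs_le.1 h5).2])]
    ring
  simp_rw [h3]
  have hqq : SmoothIn K (fun x => q x * q x) :=
    ⟨hq.smooth.mul hq.smooth, fun x hx => by rw [hq.eq_zero x hx, mul_zero]⟩
  rw [integral_sub, integral_const_mul, integral_pd_eq_zero hqq hK, mul_zero, sub_zero]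
  · exact hq.smooth.continuous.integrable_of_hasCompactSupport (hq.hasCompactSupport hK)
  · exact ((contDiff_pd hqq.smooth a).continuous.integrable_of_hasCompactSupport
      ((hqq.pd hK.isClosed a).hasCompactSupport hK)).const_mul _

/-- If `q` has vanishing integrals over lines on which the level function `ℓ` is constant, then
its tilt is a difference `u ∘ Φ - u`. -/
theorem IsTilt.rep (hK : IsCompact K) (hc : Convex ℝ K) (hKU : K ⊆ U) (hb : b ≠ 0)
    (ha : ℓ a = 1) (hℓb : ℓ b = 0) (hu : ∀ x ∈ K, u x = w (ℓ x)) (hq : SmoothIn K q)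
    (hL : DirLip (1 / 2) a q) (h0 : ∀ x, lineInt volume b q x = 0)
    (hlin : ∀ X, q X ≠ 0 → w (ℓ X) - w (ℓ X - q X) = l * q X) (hF : IsTilt a l q F) :
    Rep U u 1 F := by
  obtain ⟨g', hd, rfl⟩ := hF
  obtain ⟨R, hR, hRb⟩ := exists_primitive hq.neg hK hc hb (fun x => by
    rw [lineInt, integral_neg, neg_eq_zero]; exact h0 x)
  have hRb' : pd R b = fun x => -q x := funext hRb
  obtain ⟨Φ, hΦ, hΦX⟩ := exists_generated hK hKU hR.smooth hR.eq_zero (a := a) (b := b)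
    (by rw [hRb']; exact hL.neg)
  simp only [hRb'] at hΦX
  have hfix : ∀ Z ∉ K, Φ Z = Z := fun Z hZ => by
    have := hΦX Z
    rw [hq.eq_zero Z hZ, pd_eq_zero hK.isClosed hR.eq_zero a Z hZ] at this
    simpa using this
  obtain ⟨Ψ, -, hinj, -⟩ := IsVolDiffeo.exists_inverse hΦ
  have hKmap : ∀ Z ∈ K, Φ Z ∈ K := fun Z hZ => by
    by_contra h
    have := hinj.injective (hfix _ h)
    rw [this] at h
    exact h hZ
  have : (fun x => l * g' x) = fun x => u (Φ x) - u (id x) := by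
    funext Y
    by_cases hY : Y ∈ K
    · have h1 := hd.right Y
      have h2 := hd.symm.leftInverse Y
      have h3 := hΦX (Y + g' Y • a)
      rw [h2] at h3
      set X := Y + g' Y • a with hX
      have h4 : q X = g' Y := by linarith
      have h5 : ℓ Y = ℓ X - q X := by
        rw [hX, map_add, map_smul, ha, ← hX, h4, smul_eq_mul]; ring
      rw [id, hu _ (hKmap Y hY), hu _ hY, h3, map_add, map_smul, hℓb, h5, smul_zero, add_zero]
      by_cases h6 : q X = 0
      · rw [← h4, h6]; simp
      · rw [hlin X h6, h4]
    · have h1 := hd.left Y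
      rw [hq.eq_zero Y hY] at h1
      simp only [neg_zero, zero_smul, add_zero] at h1
      rw [hfix Y hY, h1]
      simp
  rw [this]
  exact rep_of_comp_sub hΦ isVolDiffeo_id

theorem IsTilt.rep_add (hK : IsCompact K) (hc : Convex ℝ K) (hKU : K ⊆ U) (hb : b ≠ 0)
    (ha : ℓ a = 1) (hℓb : ℓ b = 0) (hu : ∀ x ∈ K, u x = w (ℓ x)) (hq₁ : SmoothIn K q₁)
    (hq₂ : SmoothIn K q₂) (hdis : LineDisjoint a q₁ q₂)
    (hL₁ : DirLip (1 / 2) a q₁) (hL₂ : DirLip (1 / 2) a q₂)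
    (h0 : ∀ x, lineInt volume b q₁ x + lineInt volume b q₂ x = 0)
    (hlin₁ : ∀ X, q₁ X ≠ 0 → w (ℓ X) - w (ℓ X - q₁ X) = l * q₁ X)
    (hlin₂ : ∀ X, q₂ X ≠ 0 → w (ℓ X) - w (ℓ X - q₂ X) = l * q₂ X)
    (hF₁ : IsTilt a l q₁ F₁) (hF₂ : IsTilt a l q₂ F₂) :
    Rep U u 1 (fun x => F₁ x + F₂ x) ∧ ∫ x, q₁ x = -∫ x, q₂ x := by
  have h0' : ∀ x, lineInt volume b (fun x => q₁ x + q₂ x) x = 0 := fun x => by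
    rw [← h0 x, lineInt, integral_add (integrable_line hq₁ hK hb x _)
      (integrable_line hq₂ hK hb x _)]
    rfl
  constructor
  · refine IsTilt.rep (q := fun x => q₁ x + q₂ x) (l := l) (w := w) hK hc hKU hb ha hℓb hu
      (hq₁.add hq₂) (hdis.dirLip_add hL₁ hL₂) h0' (fun X hX => ?_) ?_
    · have h1 := hdis X 0
      rw [zero_smul, add_zero] at h1
      rcases h1 with h1 | h1
      · rw [h1, zero_add] at hX ⊢
        exact hlin₂ X hX
      · rw [h1, add_zero] at hX ⊢
        exact hlin₁ X hX
    · obtain ⟨g₁, hd₁, rfl⟩ := hF₁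
      obtain ⟨g₂, hd₂, rfl⟩ := hF₂
      have hdis' : LineDisjoint a (fun x => -q₁ x) (fun x => -q₂ x) := fun x t => by
        simpa using hdis x t
      refine ⟨_, ?_, (funext fun x => (mul_add l (g₁ x) (g₂ x)).symm)⟩
      simpa [neg_add_rev, add_comm] using hdis'.isDual_add hd₁ hd₂
  · obtain ⟨R, hR, hRb⟩ := exists_primitive (hq₁.add hq₂) hK hc hb h0'
    have h1 := integral_pd_eq_zero hR hK b
    simp_rw [hRb] at h1
    rw [integral_add] at h1
    · linarith
    · exact hq₁.smooth.continuous.integrable_of_hasCompactSupport (hq₁.hasCompactSupport hK)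
    · exact hq₂.smooth.continuous.integrable_of_hasCompactSupport (hq₂.hasCompactSupport hK)

end ZeroLines

/-! ### Cubes and averaging -/

section Cube

variable {d : ℕ} {c p : Euc d} {r : ℝ}

/-- The standard basis vector. -/
noncomputable abbrev ee (k : Fin d) : Euc d := EuclideanSpace.single k (1 : ℝ)

theorem ee_ne_zero (k : Fin d) : ee k ≠ 0 := by
  simp [ee]

theorem ee_self (k : Fin d) : ee k k = 1 := by simp [ee]

theorem ee_of_ne {j k : Fin d} (h : j ≠ k) : ee k j = 0 := by simp [ee, h]

/-- The closed cube with centre `c` and half-width `r`. -/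
def cube (c : Euc d) (r : ℝ) : Set (Euc d) := {x | ∀ k, |x k - c k| ≤ r}

theorem norm_le_of_abs_le (x : Euc d) (h : ∀ k, |x k| ≤ r) : ‖x‖ ≤ d * r := by
  have h1 : x = ∑ k, x k • ee k := by
    ext j
    simp [ee, Finset.sum_apply, Pi.single_apply]
  calc ‖x‖ = ‖∑ k, x k • ee k‖ := by rw [← h1]
    _ ≤ ∑ k, ‖x k • ee k‖ := norm_sum_le _ _
    _ ≤ ∑ _k : Fin d, r := by
      gcongr with k
      simpa [ee, norm_smul] using h k
    _ = d * r := by simp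

theorem cube_subset_closedBall : cube c r ⊆ Metric.closedBall c (d * r) := fun x hx => by
  rw [Metric.mem_closedBall, dist_eq_norm]
  exact norm_le_of_abs_le _ fun k => by simpa using hx k

theorem isClosed_cube : IsClosed (cube c r) := by
  have : cube c r = ⋂ k, {x : Euc d | |x k - c k| ≤ r} := by
    ext x; simp [cube]
  rw [this]
  exact isClosed_iInter fun k => isClosed_le (by fun_prop) continuous_const

theorem isCompact_cube : IsCompact (cube c r) :=
  (isCompact_closedBall c (d * r)).of_isClosed_subset isClosed_cube cube_subset_closedBall

theorem convex_cube : Convex ℝ (cube c r) := by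
  intro x hx y hy a b ha hb hab k
  have h1 : (a • x + b • y) k - c k = a * (x k - c k) + b * (y k - c k) := by
    simp only [PiLp.add_apply, PiLp.smul_apply, smul_eq_mul]
    linear_combination c k * hab
  rw [h1]
  calc _ ≤ a * |x k - c k| + b * |y k - c k| := by
        refine (abs_add_le _ _).trans (by rw [abs_mul, abs_mul, abs_of_nonneg ha, abs_of_nonneg hb])
    _ ≤ a * r + b * r := by gcongr; exacts [hx k, hy k]
    _ = r := by rw [← add_mul, hab, one_mul]

theorem mem_cube_self (hr : 0 ≤ r) : c ∈ cube c r := fun k => by simpa using hr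

theorem cube_subset_cube {c' : Euc d} {r' : ℝ} (h : ∀ k, |c k - c' k| + r ≤ r') :
    cube c r ⊆ cube c' r' := fun x hx k => by
  have h1 := abs_add_le (x k - c k) (c k - c' k)
  rw [sub_add_sub_cancel] at h1
  linarith [hx k, h k]

theorem exists_cube_subset {V : Set (Euc d)} (hV : IsOpen V) (hp : p ∈ V) :
    ∃ r > 0, cube p r ⊆ V := by
  obtain ⟨ε, hε, h⟩ := Metric.isOpen_iff.1 hV p hp
  refine ⟨ε / (d + 1), by positivity, fun x hx => h ?_⟩
  have h1 := cube_subset_closedBall hx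
  rw [Metric.mem_closedBall] at h1
  rw [Metric.mem_ball]
  refine h1.trans_lt ?_
  have : (0 : ℝ) < d + 1 := by positivity
  rw [← mul_div_assoc, div_lt_iff₀ this]
  nlinarith

theorem cube_mem_nhds (hr : 0 < r) : cube c r ∈ nhds c := by
  refine Filter.mem_of_superset (Metric.ball_mem_nhds c hr) fun x hx k => ?_
  rw [Metric.mem_ball, dist_eq_norm] at hx
  have := PiLp.norm_apply_le (x - c) k
  rw [PiLp.sub_apply, Real.norm_eq_abs] at this
  linarith

theorem lineDisjoint_of_coord {g₁ g₂ : Euc d → ℝ} {c' : Euc d} {k : Fin d} {a : Euc d}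
    (h₁ : SmoothIn (cube c r) g₁) (h₂ : SmoothIn (cube c' r) g₂) (ha : a k = 0)
    (h : 2 * r < |c k - c' k|) : LineDisjoint a g₁ g₂ := fun x t => by
  by_contra! hne
  have h3 : x ∈ cube c r := by
    by_contra hx; exact hne.1 (h₁.eq_zero x hx)
  have h4 : x + t • a ∈ cube c' r := by
    by_contra hx; exact hne.2 (h₂.eq_zero _ hx)
  have h5 := h3 k
  have h6 := h4 k
  rw [PiLp.add_apply, PiLp.smul_apply, ha, smul_zero, add_zero] at h6
  have h7 := abs_sub_le (c k) (x k) (c' k)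
  rw [abs_sub_comm (c k) (x k)] at h7
  linarith

end Cube

section Avg

/-- A smooth probability density on `[-1, 1]`, bounded and Lipschitz with constant `C`. -/
structure IsKernel (C : ℝ) (β : ℝ → ℝ) : Prop where
  smooth : ContDiff ℝ (⊤ : ℕ∞) β
  nonneg : ∀ t, 0 ≤ β t
  eq_zero : ∀ t, 1 < |t| → β t = 0
  integral : ∫ t, β t = 1
  bound : ∀ t, |β t| ≤ C
  lip : ∀ s t, |β s - β t| ≤ C * |s - t|
  one_le : 1 ≤ C

theorem exists_lipschitz_of_hasCompactSupport {β : ℝ → ℝ} (h : ContDiff ℝ (⊤ : ℕ∞) β)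
    (hc : HasCompactSupport β) :
    ∃ C, 1 ≤ C ∧ (∀ t, |β t| ≤ C) ∧ ∀ s t, |β s - β t| ≤ C * |s - t| := by
  obtain ⟨C₁, hC₁⟩ := hc.exists_bound_of_continuous h.continuous
  obtain ⟨C₂, hC₂⟩ := hc.deriv.exists_bound_of_continuous (h.continuous_deriv (by simp))
  refine ⟨max 1 (max C₁ C₂), le_max_left _ _, fun t => ?_, fun s t => ?_⟩
  · exact (hC₁ t).trans ((le_max_left _ _).trans (le_max_right _ _))
  · exact Convex.norm_image_sub_le_of_norm_deriv_le (s := Set.univ)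
      (fun x _ => h.differentiable (by simp) x)
      (fun x _ => (hC₂ x).trans ((le_max_right _ _).trans (le_max_right _ _))) convex_univ
      (Set.mem_univ _) (Set.mem_univ _)

theorem exists_isKernel : ∃ C β, IsKernel C β := by
  let φ : ContDiffBump (0 : ℝ) := ⟨1 / 2, 1, by norm_num, by norm_num⟩
  have hs : ContDiff ℝ (⊤ : ℕ∞) (φ.normed volume) := φ.contDiff_normed
  obtain ⟨C, h1, h2, h3⟩ := exists_lipschitz_of_hasCompactSupport hs φ.hasCompactSupport_normed
  refine ⟨C, _, hs, φ.nonneg_normed, fun t ht => ?_, φ.integral_normed, h2, h3, h1⟩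
  by_contra h
  have : t ∈ Function.support (φ.normed volume) := h
  rw [φ.support_normed_eq, Metric.mem_ball, Real.dist_eq, sub_zero] at this
  exact absurd this (not_lt.2 ht.le)

variable {d : ℕ} {c : Euc d} {r : ℝ} {k : Fin d} {g : Euc d → ℝ} {C : ℝ} {β : ℝ → ℝ}

theorem abs_integral_le_of_slab {h : ℝ → ℝ} {s r A : ℝ} (hr : 0 < r)
    (h0 : ∀ t, r < |t - s| → h t = 0) (hA : ∀ t, |h t| ≤ A) : |∫ t, h t| ≤ 2 * r * A := by
  rw [← setIntegral_eq_integral_of_forall_compl_eq_zero (s := Set.Icc (s - r) (s + r))]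
  · have := norm_setIntegral_le_of_norm_le_const (μ := volume) (s := Set.Icc (s - r) (s + r))
      (f := h) (C := A) (by simp) fun t _ => hA t
    rw [Real.norm_eq_abs] at this
    refine this.trans (le_of_eq ?_)
    rw [Measure.real, Real.volume_Icc, ENNReal.toReal_ofReal (by linarith)]
    ring
  · intro t ht
    refine h0 t ?_
    by_contra h
    rw [not_lt, abs_le] at h
    exact ht ⟨by linarith, by linarith⟩

theorem lineInt_add_smul (e x : Euc d) (t : ℝ) :
    lineInt volume e g (x + t • e) = lineInt volume e g x := by
  rw [lineInt, lineInt, ← integral_add_left_eq_self (fun s => g (x + s • e)) t]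
  simp only [add_smul, add_assoc]

theorem SmoothIn.eq_zero_line (h : SmoothIn (cube c r) g) (x : Euc d) (t : ℝ)
    (ht : r < |t - (c k - x k)|) : g (x + t • ee k) = 0 := by
  refine h.eq_zero _ fun hm => ?_
  have := hm k
  rw [PiLp.add_apply, PiLp.smul_apply, ee_self, smul_eq_mul, mul_one] at this
  rw [show x k + t - c k = t - (c k - x k) by ring] at this
  linarith

theorem abs_lineInt_le (h : SmoothIn (cube c r) g) (hr : 0 < r) {A : ℝ} (hA : ∀ x, |g x| ≤ A)
    (x : Euc d) : |lineInt volume (ee k) g x| ≤ 2 * r * A :=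
  abs_integral_le_of_slab (s := c k - x k) hr (h.eq_zero_line x) fun _ => hA _

theorem dirLip_lineInt (h : SmoothIn (cube c r) g) (hr : 0 < r) {κ : ℝ} {v : Euc d}
    (hv : v k = 0) (hL : DirLip κ v g) : DirLip (2 * r * κ) v (lineInt volume (ee k) g) := by
  intro x t
  rw [lineInt, lineInt, ← integral_sub (integrable_line h isCompact_cube (ee_ne_zero k) _ _)
    (integrable_line h isCompact_cube (ee_ne_zero k) _ _), mul_assoc]
  refine abs_integral_le_of_slab (s := c k - x k) hr (fun s hs => ?_) fun s => ?_
  · rw [h.eq_zero_line x s hs, h.eq_zero_line _ s, sub_zero]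
    simpa [hv] using hs
  · have := hL (x + s • ee k) t
    rwa [add_right_comm] at this

/-- The function with the same integrals as `g` over lines in the `k`-th direction and a
prescribed profile along these lines, centred at height `s`. -/
noncomputable def avg (β : ℝ → ℝ) (r s : ℝ) (k : Fin d) (g : Euc d → ℝ) (x : Euc d) : ℝ :=
  β ((x k - s) / r) / r * lineInt volume (ee k) g x

theorem SmoothIn.avg (hβ : IsKernel C β) (hr : 0 < r) (h : SmoothIn (cube c r) g) (s : ℝ) :
    SmoothIn (cube (c + (s - c k) • ee k) r) (avg β r s k g) := by
  constructor
  · refine ContDiff.mul ?_ (contDiff_lineInt h isCompact_cube (ee_ne_zero k) _)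
    refine ContDiff.div_const (hβ.smooth.comp ?_) _
    fun_prop
  · intro x hx
    rw [VolFlex.avg]
    by_cases hk : r < |x k - s|
    · rw [hβ.eq_zero, zero_div, zero_mul]
      rwa [abs_div, abs_of_pos hr, lt_div_iff₀ hr, one_mul]
    · rw [lineInt, integral_eq_zero_of_ae, mul_zero]
      refine Filter.Eventually.of_forall fun t => h.eq_zero _ fun hm => hx fun j => ?_
      rcases eq_or_ne j k with rfl | hj
      · simpa using not_lt.1 hk
      · simpa [hj] using hm j

theorem abs_avg_le (hβ : IsKernel C β) (hr : 0 < r) (h : SmoothIn (cube c r) g) (s : ℝ) {A : ℝ}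
    (hA : ∀ x, |g x| ≤ A) (x : Euc d) : |avg β r s k g x| ≤ 2 * C * A := by
  rw [avg, abs_mul, abs_div, abs_of_pos hr]
  calc _ ≤ C / r * (2 * r * A) := by
        gcongr
        · have := hβ.one_le; positivity
        · exact hβ.bound _
        · exact abs_lineInt_le h hr hA x
    _ = 2 * C * A := by field_simp

theorem dirLip_avg (hβ : IsKernel C β) (hr : 0 < r) (h : SmoothIn (cube c r) g) (s : ℝ) {κ : ℝ}
    {v : Euc d} (hv : v k = 0) (hL : DirLip κ v g) : DirLip (2 * C * κ) v (avg β r s k g) := by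
  intro x t
  have h1 : (x + t • v) k = x k := by simp [hv]
  rw [avg, avg, h1, ← mul_sub, abs_mul, abs_div, abs_of_pos hr]
  calc _ ≤ C / r * (2 * r * κ * |t|) := by
        gcongr
        · have := hβ.one_le; positivity
        · exact hβ.bound _
        · exact dirLip_lineInt h hr hv hL x t
    _ = 2 * C * κ * |t| := by field_simp

theorem dirLip_avg_self (hβ : IsKernel C β) (hr : 0 < r) (h : SmoothIn (cube c r) g) (s : ℝ)
    {A : ℝ} (hA : ∀ x, |g x| ≤ A) : DirLip (2 * C * A / r) (ee k) (avg β r s k g) := by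
  intro x t
  have h1 : (x + t • ee k) k = x k + t := by simp
  rw [avg, avg, h1, lineInt_add_smul, ← sub_mul, ← sub_div, abs_mul, abs_div, abs_of_pos hr]
  have h2 := hβ.lip ((x k + t - s) / r) ((x k - s) / r)
  rw [← sub_div, show x k + t - s - (x k - s) = t by ring, abs_div, abs_of_pos hr] at h2
  calc _ ≤ C * (|t| / r) / r * (2 * r * A) := by
        gcongr
        · have := hβ.one_le; positivity
        · exact abs_lineInt_le h hr hA x
    _ = 2 * C * A / r * |t| := by field_simp

theorem lineInt_avg (hβ : IsKernel C β) (hr : 0 < r) (s : ℝ) (x : Euc d) :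
    lineInt volume (ee k) (avg β r s k g) x = lineInt volume (ee k) g x := by
  have h1 : ∀ t : ℝ, avg β r s k g (x + t • ee k)
      = β ((t + (x k - s)) / r) * (lineInt volume (ee k) g x / r) := fun t => by
    rw [avg, lineInt_add_smul]
    simp only [PiLp.add_apply, PiLp.smul_apply, ee_self, smul_eq_mul, mul_one]
    rw [show x k + t - s = t + (x k - s) by ring]
    ring
  rw [lineInt]
  simp_rw [h1]
  rw [integral_mul_const, integral_add_right_eq_self (fun t => β (t / r)),
    Measure.integral_comp_div, hβ.integral, abs_of_pos hr, smul_eq_mul]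
  field_simp

theorem integral_avg (hβ : IsKernel C β) (hr : 0 < r) (h : SmoothIn (cube c r) g) (s : ℝ) :
    ∫ x, avg β r s k g x = ∫ x, g x := by
  have ha := h.avg (k := k) hβ hr s
  obtain ⟨ρ, hρ⟩ : ∃ ρ, cube c r ⊆ cube c ρ ∧ cube (c + (s - c k) • ee k) r ⊆ cube c ρ := by
    refine ⟨r + |s - c k|, cube_subset_cube fun j => ?_, cube_subset_cube fun j => ?_⟩
    · simp
    · rcases eq_or_ne j k with rfl | hj
      · simp [add_comm]
      · simp [hj]
  have h1 := (h.mono hρ.1)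
  have h2 := (ha.mono hρ.2)
  obtain ⟨R, hR, hRb⟩ := exists_primitive (h1.add h2.neg) isCompact_cube convex_cube
    (ee_ne_zero k) (fun x => by
      have := integral_add (integrable_line h1 isCompact_cube (ee_ne_zero k) x volume)
        (integrable_line h2.neg isCompact_cube (ee_ne_zero k) x volume)
      rw [lineInt, this, integral_neg]
      have := lineInt_avg (g := g) (k := k) hβ hr s x
      rw [lineInt, lineInt] at this
      rw [this, add_neg_cancel])
  have h3 := integral_pd_eq_zero hR isCompact_cube (ee k)
  simp_rw [hRb] at h3
  rw [integral_add, integral_neg] at h3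
  · linarith
  · exact h1.smooth.continuous.integrable_of_hasCompactSupport (h1.hasCompactSupport isCompact_cube)
  · exact h2.neg.smooth.continuous.integrable_of_hasCompactSupport
      (h2.neg.hasCompactSupport isCompact_cube)

end Avg

/-! ### Shearing the level sets of an affine function -/

section Level

variable {d : ℕ} {U : Set (Euc d)} {p : Euc d} {r a c : ℝ} {i j : Fin d} {u : Euc d → ℝ}

theorem exists_cutoff {K V : Set (Euc d)} (hK : IsClosed K) (hV : IsOpen V) (hKV : K ⊆ V) :
    ∃ ψ : Euc d → ℝ, SmoothIn V ψ ∧ (∀ x ∈ K, ψ x = 1) ∧ ∀ x, ψ x ∈ Set.Icc (0 : ℝ) 1 := by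
  obtain ⟨ψ, h1, h2, h3⟩ := exists_contMDiffMap_zero_one_of_isClosed (n := (⊤ : ℕ∞))
    (modelWithCornersSelf ℝ (Euc d)) hV.isClosed_compl hK
    (Set.disjoint_left.2 fun x hx hxK => hx (hKV hxK))
  exact ⟨ψ, ⟨ψ.contMDiff.contDiff, fun x hx => h1 hx⟩, fun x hx => h2 hx, h3⟩

theorem pd_coord_mul {σ : ℝ → ℝ} {h : Euc d → ℝ} (hσ : ContDiff ℝ (⊤ : ℕ∞) σ)
    (hh : ContDiff ℝ (⊤ : ℕ∞) h) (j : Fin d) (v x : Euc d) :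
    pd (fun x => σ (x j) * h x) v x = deriv σ (x j) * v j * h x + σ (x j) * pd h v x := by
  have h1 : HasFDerivAt (fun x : Euc d => x j) (EuclideanSpace.proj j : Euc d →L[ℝ] ℝ) x :=
    (EuclideanSpace.proj j : Euc d →L[ℝ] ℝ).hasFDerivAt
  have h2 : HasFDerivAt (fun x : Euc d => σ (x j)) _ x :=
    (hσ.differentiable (by simp) (x j)).hasDerivAt.comp_hasFDerivAt x h1
  have h3 := h2.mul (hh.differentiable (by simp) x).hasFDerivAt
  rw [pd, (show HasFDerivAt (fun x : Euc d => σ (x j) * h x) _ x from h3).fderiv]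
  simp [pd]
  ring

theorem contDiff_coord_mul {σ : ℝ → ℝ} {h : Euc d → ℝ} (hσ : ContDiff ℝ (⊤ : ℕ∞) σ)
    (hh : ContDiff ℝ (⊤ : ℕ∞) h) (j : Fin d) : ContDiff ℝ (⊤ : ℕ∞) (fun x => σ (x j) * h x) :=
  (hσ.comp (by fun_prop)).mul hh

/-- If `u` is affine near a cube, then small shears of its level sets are realised there by
compositions `u ∘ Φ`. -/
theorem exists_level (hij : i ≠ j) (hr : 0 < r) (hU : cube p (12 * r) ⊆ U)
    (hu : ∀ x ∈ cube p (12 * r), u x = a * x i + c) :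
    ∃ η > 0, ∀ σ : ℝ → ℝ, ContDiff ℝ (⊤ : ℕ∞) σ →
      (∀ t, |t - p j| ≤ 12 * r → |σ t| ≤ η ∧ |deriv σ t| ≤ η) →
      ∃ Φ, IsVolDiffeoSuppIn d U Φ ∧
        ∀ x ∈ cube p (8 * r), u (Φ x) = a * (x i + deriv σ (x j)) + c := by
  obtain ⟨V, hVo, hKV, hVK⟩ : ∃ V : Set (Euc d), IsOpen V ∧ cube p (10 * r) ⊆ V ∧
      V ⊆ cube p (12 * r) := by
    refine ⟨⋂ k, {x | |x k - p k| < 12 * r}, isOpen_iInter_of_finite fun k =>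
      isOpen_lt (by fun_prop) continuous_const, fun x hx => Set.mem_iInter.2 fun k => ?_,
      fun x hx k => (Set.mem_iInter.1 hx k).le⟩
    exact (hx k).trans_lt (by linarith)
  obtain ⟨ψ, hψ, hψ1, -⟩ := exists_cutoff isClosed_cube hVo hKV
  replace hψ := hψ.mono hVK
  have hψi := hψ.pd isClosed_cube (ee i)
  have hψij := hψi.pd isClosed_cube (ee j)
  obtain ⟨A, hA0, hA⟩ := hψi.exists_bound isCompact_cube
  obtain ⟨D, hD0, hD⟩ := hψij.exists_bound isCompact_cube
  have hAD : 0 < A + D + 1 := by positivity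
  refine ⟨min r (1 / 2 / (A + D + 1)), by positivity, fun σ hσ hση => ?_⟩
  have hS := contDiff_coord_mul hσ hψ.smooth j
  have hS0 : ∀ x ∉ cube p (12 * r), σ (x j) * ψ x = 0 := fun x hx => by
    rw [hψ.eq_zero x hx, mul_zero]
  have hSi : pd (fun x => σ (x j) * ψ x) (ee i) = fun x => σ (x j) * pd ψ (ee i) x :=
    funext fun x => by rw [pd_coord_mul hσ hψ.smooth, ee_of_ne hij.symm]; ring
  have hL : DirLip (1 / 2) (ee j) (pd (fun x => σ (x j) * ψ x) (ee i)) := by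
    rw [hSi]
    refine dirLip_of_fderiv_le (contDiff_coord_mul hσ hψi.smooth j) fun x => ?_
    change |pd _ _ _| ≤ _
    rw [pd_coord_mul hσ hψi.smooth, ee_self, mul_one]
    by_cases hx : x ∈ cube p (12 * r)
    · have h1 := hση (x j) (hx j)
      calc _ ≤ |deriv σ (x j)| * |pd ψ (ee i) x| + |σ (x j)| * |pd (pd ψ (ee i)) (ee j) x| := by
            rw [← abs_mul, ← abs_mul]; exact abs_add_le _ _
        _ ≤ (1 / 2 / (A + D + 1)) * A + (1 / 2 / (A + D + 1)) * D := by
            gcongr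
            · exact h1.2.trans (min_le_right _ _)
            · exact hA x
            · exact h1.1.trans (min_le_right _ _)
            · exact hD x
        _ ≤ 1 / 2 := by
            rw [← mul_add, div_mul_eq_mul_div, div_le_iff₀ hAD]
            linarith
    · rw [hψi.eq_zero x hx, hψij.eq_zero x hx]
      norm_num
  obtain ⟨Φ, hΦ, hΦX⟩ := exists_generated isCompact_cube hU hS hS0 hL
  refine ⟨Φ, hΦ, fun x hx => ?_⟩
  have hev : ψ =ᶠ[nhds x] fun _ => 1 := by
    have : cube p (10 * r) ∈ nhds x := by
      refine Filter.mem_of_superset (cube_mem_nhds (c := x) hr) (cube_subset_cube fun k => ?_)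
      linarith [hx k]
    filter_upwards [this] with y hy using hψ1 y hy
  have hpd : ∀ v, pd ψ v x = 0 := fun v => by
    rw [pd, hev.fderiv_eq]; simp
  have h1 := hΦX x
  have hx12 : |x j - p j| ≤ 12 * r := (hx j).trans (by linarith)
  rw [pd_coord_mul hσ hψ.smooth, pd_coord_mul hσ hψ.smooth, hpd, hpd, hev.eq_of_nhds, ee_self,
    ee_of_ne hij.symm] at h1
  simp only [mul_zero, add_zero, zero_smul, mul_one] at h1
  rw [h1, hu]
  · simp
  · refine cube_subset_cube (c := x) (r := r) (fun k => by linarith [hx k]) fun k => ?_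
    have h2 := (hση (x j) hx12).2.trans (min_le_left _ _)
    rcases eq_or_ne k i with rfl | hk
    · simpa using h2
    · simpa [hk] using hr.le

end Level

/-! ### Periodic waves -/

section Waves

theorem exists_periodize {g : ℝ → ℝ} (hg : ContDiff ℝ (⊤ : ℕ∞) g)
    (h0 : ∀ t, 9 / 20 ≤ |t| → g t = 0) :
    ∃ P : ℝ → ℝ, ContDiff ℝ (⊤ : ℕ∞) P ∧
      ∀ (k : ℤ) (t : ℝ), |t - k| < 11 / 20 → P t = g (t - k) := by
  have key : ∀ (k : ℤ) (t : ℝ), |t - k| < 11 / 20 → g (t - round t) = g (t - k) := fun k t ht => by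
    by_cases hk : round t = k
    · rw [hk]
    · have h1 := abs_sub_round t
      have h2 : (1 : ℝ) ≤ |(round t : ℝ) - k| := by
        exact_mod_cast Int.one_le_abs (sub_ne_zero.2 hk)
      have h3 : |(round t : ℝ) - k| ≤ |t - round t| + |t - k| := by
        rw [abs_sub_comm t (round t)]
        exact abs_sub_le _ _ _
      rw [h0 _ (by linarith), h0 _ (by linarith)]
  refine ⟨fun t => g (t - round t), contDiff_iff_contDiffAt.2 fun t => ?_, key⟩
  have h1 : ContDiffAt ℝ (⊤ : ℕ∞) (fun s => g (s - round t)) t :=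
    (hg.comp (by fun_prop)).contDiffAt
  refine h1.congr_of_eventuallyEq ?_
  have h2 := abs_sub_round t
  filter_upwards [Metric.ball_mem_nhds t (show (0 : ℝ) < 1 / 20 by norm_num)] with s hs
  rw [Metric.mem_ball, Real.dist_eq] at hs
  exact key _ _ (by linarith [abs_sub_le s t (round t)])

theorem deriv_eq_of_periodize {P g : ℝ → ℝ}
    (h : ∀ (k : ℤ) (t : ℝ), |t - k| < 11 / 20 → P t = g (t - k)) (k : ℤ) (t : ℝ)
    (ht : |t - k| < 11 / 20) : deriv P t = deriv g (t - k) := by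
  have h1 : P =ᶠ[nhds t] fun s => g (s - k) := by
    have : IsOpen {s : ℝ | |s - k| < 11 / 20} := isOpen_lt (by fun_prop) continuous_const
    filter_upwards [this.mem_nhds ht] with s hs using h k s hs
  rw [h1.deriv_eq]
  exact deriv_comp_sub_const g _ _

theorem exists_bump (a b : ℝ) (ha : 0 < a) (hab : a < b) : ∃ h : ℝ → ℝ, ContDiff ℝ (⊤ : ℕ∞) h ∧
    (∀ t, |t| ≤ a → h t = 1) ∧ ∀ t, b ≤ |t| → h t = 0 := by
  let φ : ContDiffBump (0 : ℝ) := ⟨a, b, ha, hab⟩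
  refine ⟨φ, φ.contDiff, fun t ht => φ.one_of_mem_closedBall (by simpa using ht), fun t ht =>
    φ.zero_of_le_dist (by simpa using ht)⟩

/-- A partition of unity `χ₀ + χ₁ = 1` of the line and bounded functions `P₀`, `P₁` such that
`P_s'` has slope one near the support of `χ_s`. -/
theorem exists_waves : ∃ C, ∃ P χ : Fin 2 → ℝ → ℝ, 1 ≤ C ∧
    (∀ s, ContDiff ℝ (⊤ : ℕ∞) (P s)) ∧ (∀ s, ContDiff ℝ (⊤ : ℕ∞) (χ s)) ∧
    (∀ s t, |P s t| ≤ C) ∧ (∀ s t, |deriv (P s) t| ≤ C) ∧ (∀ s t, |χ s t| ≤ C) ∧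
    (∀ s t, |deriv (χ s) t| ≤ C) ∧ (∀ t, χ 0 t + χ 1 t = 1) ∧
    ∀ s t τ τ', χ s t ≠ 0 → |τ| ≤ 1 / 10 → |τ'| ≤ 1 / 10 →
      deriv (P s) (t + τ) - deriv (P s) (t + τ') = τ - τ' := by
  obtain ⟨φ, hφ, hφ1, hφ0⟩ := exists_bump (43 / 100) (9 / 20) (by norm_num) (by norm_num)
  obtain ⟨h, hh, hh1, hh0⟩ := exists_bump (1 / 5) (3 / 10) (by norm_num) (by norm_num)
  set g : ℝ → ℝ := fun t => 1 / 2 * t ^ 2 * φ t with hg_def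
  have hg : ContDiff ℝ (⊤ : ℕ∞) g := by
    have : ContDiff ℝ (⊤ : ℕ∞) fun t : ℝ => 1 / 2 * t ^ 2 := by fun_prop
    exact this.mul hφ
  have hg0 : ∀ t, 9 / 20 ≤ |t| → g t = 0 := fun t ht => by simp [hg_def, hφ0 t ht]
  have hgd : ∀ t, |t| < 43 / 100 → deriv g t = t := fun t ht => by
    have h1 : g =ᶠ[nhds t] fun t => 1 / 2 * t ^ 2 := by
      have : IsOpen {s : ℝ | |s| < 43 / 100} := isOpen_lt (by fun_prop) continuous_const
      filter_upwards [this.mem_nhds ht] with s hs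
      simp [hg_def, hφ1 s (le_of_lt hs)]
    rw [h1.deriv_eq]
    simp
  have hgc : HasCompactSupport g := HasCompactSupport.intro (isCompact_Icc (a := -1) (b := 1))
    fun t ht => hg0 t (by
      by_contra h'
      have := abs_lt.1 (not_le.1 h')
      exact ht ⟨by linarith, by linarith⟩)
  have hhc : HasCompactSupport h := HasCompactSupport.intro (isCompact_Icc (a := -1) (b := 1))
    fun t ht => hh0 t (by
      by_contra h'
      have := abs_lt.1 (not_le.1 h')
      exact ht ⟨by linarith, by linarith⟩)
  obtain ⟨C₁, hC₁⟩ := hgc.exists_bound_of_continuous hg.continuous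
  obtain ⟨C₂, hC₂⟩ := hgc.deriv.exists_bound_of_continuous (hg.continuous_deriv (by simp))
  obtain ⟨C₃, hC₃⟩ := hhc.exists_bound_of_continuous hh.continuous
  obtain ⟨C₄, hC₄⟩ := hhc.deriv.exists_bound_of_continuous (hh.continuous_deriv (by simp))
  simp only [Real.norm_eq_abs] at hC₁ hC₂ hC₃ hC₄
  obtain ⟨P, hP, hPk⟩ := exists_periodize hg hg0
  obtain ⟨χ, hχ, hχk⟩ := exists_periodize hh (fun t ht => hh0 t (by linarith))
  have hr : ∀ t : ℝ, |t - round t| < 11 / 20 := fun t => (abs_sub_round t).trans_lt (by norm_num)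
  have hPd := deriv_eq_of_periodize hPk
  have hP1 : ∀ t, |P t| ≤ C₁ := fun t => by rw [hPk _ t (hr t)]; exact hC₁ _
  have hP2 : ∀ t, |deriv P t| ≤ C₂ := fun t => by rw [hPd _ t (hr t)]; exact hC₂ _
  have hχ1 : ∀ t, |χ t| ≤ C₃ := fun t => by rw [hχk _ t (hr t)]; exact hC₃ _
  have hχ2 : ∀ t, |deriv χ t| ≤ C₄ := fun t => by
    rw [deriv_eq_of_periodize hχk _ t (hr t)]; exact hC₄ _
  have hs : ∀ t : ℝ, deriv (fun t => P (t + 1 / 2)) t = deriv P (t + 1 / 2) := fun t =>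
    deriv_comp_add_const P _ _
  have hs' : ∀ t : ℝ, deriv (fun t => 1 - χ t) t = - deriv χ t := fun t => by
    rw [deriv_const_sub]
  have hlin : ∀ (k : ℤ) (t : ℝ), |t - k| < 33 / 100 → ∀ τ, |τ| ≤ 1 / 10 →
      deriv P (t + τ) = t + τ - k := fun k t ht τ hτ => by
    have h1 : |t + τ - k| < 43 / 100 := by
      have := abs_add_le (t - k) τ
      rw [sub_add_eq_add_sub] at this
      linarith
    rw [hPd k _ (h1.trans (by norm_num)), hgd _ h1]
  have := (abs_nonneg _).trans (hC₁ 0)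
  have := (abs_nonneg _).trans (hC₂ 0)
  have := (abs_nonneg _).trans (hC₃ 0)
  have := (abs_nonneg _).trans (hC₄ 0)
  refine ⟨C₁ + C₂ + C₃ + C₄ + 1, ![P, fun t => P (t + 1 / 2)], ![χ, fun t => 1 - χ t],
    by linarith, ?_, ?_, ?_, ?_, ?_, ?_, ?_, ?_⟩
  · exact Fin.forall_fin_two.2 ⟨hP, hP.comp (by fun_prop)⟩
  · exact Fin.forall_fin_two.2 ⟨hχ, contDiff_const.sub hχ⟩
  · exact Fin.forall_fin_two.2 ⟨fun t => (hP1 t).trans (by linarith),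
      fun t => (hP1 _).trans (by linarith)⟩
  · refine Fin.forall_fin_two.2 ⟨fun t => (hP2 t).trans (by linarith), fun t => ?_⟩
    change |deriv (fun t => P (t + 1 / 2)) t| ≤ _
    rw [hs]
    exact (hP2 _).trans (by linarith)
  · refine Fin.forall_fin_two.2 ⟨fun t => (hχ1 t).trans (by linarith), fun t => ?_⟩
    change |1 - χ t| ≤ _
    have := abs_sub 1 (χ t)
    rw [abs_one] at this
    linarith [hχ1 t]
  · refine Fin.forall_fin_two.2 ⟨fun t => (hχ2 t).trans (by linarith), fun t => ?_⟩
    change |deriv (fun t => 1 - χ t) t| ≤ _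
    rw [hs', abs_neg]
    exact (hχ2 _).trans (by linarith)
  · intro t
    simp
  · refine Fin.forall_fin_two.2 ⟨fun t τ τ' ht hτ hτ' => ?_, fun t τ τ' ht hτ hτ' => ?_⟩
    · change χ t ≠ 0 at ht
      change deriv P (t + τ) - deriv P (t + τ') = _
      have h1 : |t - round t| < 33 / 100 := by
        by_contra h'
        rw [hχk _ t (hr t), hh0 _ (by linarith)] at ht
        exact ht rfl
      rw [hlin _ t h1 _ hτ, hlin _ t h1 _ hτ']
      ring
    · change 1 - χ t ≠ 0 at ht
      change deriv (fun t => P (t + 1 / 2)) (t + τ) - deriv (fun t => P (t + 1 / 2)) (t + τ') = _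
      have h1 : ∃ k : ℤ, |t + 1 / 2 - k| < 33 / 100 := by
        have h2 : 1 / 5 < |t - round t| := by
          by_contra h'
          rw [hχk _ t (hr t), hh1 _ (by linarith)] at ht
          exact ht (sub_self _)
        have h3 := abs_le.1 (abs_sub_round t)
        rcases le_or_gt 0 (t - round t) with h4 | h4
        · rw [abs_of_nonneg h4] at h2
          refine ⟨round t + 1, abs_lt.2 ⟨?_, ?_⟩⟩ <;> push_cast <;> linarith
        · rw [abs_of_neg h4] at h2
          refine ⟨round t, abs_lt.2 ⟨?_, ?_⟩⟩ <;> linarith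
      obtain ⟨k, hk⟩ := h1
      rw [hs, hs, add_right_comm t τ, add_right_comm t τ', hlin k _ hk _ hτ, hlin k _ hk _ hτ']
      ring

end Waves

/-! ### Trading size of derivatives in one direction -/

section Wild

variable {d : ℕ} {U : Set (Euc d)} {p : Euc d} {r a c C : ℝ} {i j : Fin d} {u : Euc d → ℝ}
  {β : ℝ → ℝ}

theorem lineInt_ne_zero {g : Euc d → ℝ} {e x : Euc d} (h : lineInt volume e g x ≠ 0) :
    ∃ t : ℝ, g (x + t • e) ≠ 0 := by
  by_contra! h0
  exact h (by simp [lineInt, h0])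

theorem exists_average_tilt (hβ : IsKernel C β) (hij : i ≠ j) (hr : 0 < r)
    (hU : cube p (8 * r) ⊆ U) {V G : Euc d → ℝ} {w : ℝ → ℝ} {l m : ℝ}
    (hV : ∀ x ∈ cube p (8 * r), V x = w (x j)) (hG : SmoothIn (cube p r) G)
    (hL : DirLip (1 / (16 * C)) (ee j) G) (hm : ∀ x, |G x| ≤ m)
    (hlin : ∀ X, G X ≠ 0 → ∀ τ τ', |τ| ≤ 3 * C * m → |τ'| ≤ 3 * C * m →
      w (X j + τ) - w (X j + τ') = l * (τ - τ')) :
    ∃ G', SmoothIn (cube (p + (3 * r) • ee i) r) G' ∧ (∀ x, |G' x| ≤ |l| * (2 * C * m)) ∧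
      DirLip (|l| * (2 * (2 * C * m / r))) (ee i) G' ∧ ∫ x, G' x = -∫ x, l * G x ∧
      Rep U V 1 (fun x => l * G x + G' x) := by
  have hC := hβ.one_le
  have hm0 : 0 ≤ m := (abs_nonneg _).trans (hm 0)
  have hκ : 1 / (16 * C) ≤ 1 / 16 := by
    rw [div_le_div_iff₀ (by positivity) (by norm_num)]; linarith
  obtain ⟨q, hqt, hq, hqL, hqm, hqG⟩ := exists_untilt hG (by linarith) hL l
  replace hqL := hqL _ _ hL
  replace hqm := hqm m hm
  set s := p i + 3 * r with hs
  have hi : (ee j : Euc d) i = 0 := ee_of_ne hij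
  have hj : (ee i : Euc d) j = 0 := ee_of_ne hij.symm
  have hρ : SmoothIn (cube (p + (3 * r) • ee i) r) (fun x => -avg β r s i q x) := by
    have := (hq.avg (k := i) hβ hr s).neg
    rwa [hs, add_sub_cancel_left] at this
  have hρL : DirLip (1 / 2) (ee j) (fun x => -avg β r s i q x) :=
    ((dirLip_avg hβ hr hq s hi hqL).mono (by
      have : 2 * C * (2 * (1 / (16 * C))) = 1 / 4 := by field_simp; norm_num
      rw [this]; norm_num)).neg
  have hρm : ∀ x, |-avg β r s i q x| ≤ 2 * C * m := fun x => by
    rw [abs_neg]; exact abs_avg_le hβ hr hq s hqm x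
  have hρi : DirLip (2 * C * m / r) (ee i) (fun x => -avg β r s i q x) :=
    (dirLip_avg_self hβ hr hq s hqm).neg
  obtain ⟨G', hG't, hG', hG'L, hG'm⟩ := exists_tilt hρ le_rfl hρL l
  have hcube₁ : cube p r ⊆ cube p (8 * r) := cube_subset_cube fun k => by simp; linarith
  have hcube₂ : cube (p + (3 * r) • ee i) r ⊆ cube p (8 * r) := cube_subset_cube fun k => by
    rcases eq_or_ne k i with rfl | hk
    · simp [abs_of_pos hr]; linarith
    · simp [hk]; linarith
  have hrep := IsTilt.rep_add (u := V) (w := w) (U := U) (b := ee i)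
    (ℓ := (EuclideanSpace.proj j : Euc d →L[ℝ] ℝ)) isCompact_cube convex_cube hU (ee_ne_zero i)
    (by simp) (by simpa using hj) hV (hq.mono hcube₁) (hρ.mono hcube₂)
    (lineDisjoint_of_coord hq hρ hi (by
      simp only [PiLp.add_apply, PiLp.smul_apply, ee_self, smul_eq_mul, mul_one,
        sub_add_cancel_left, abs_neg]
      rw [abs_of_pos (by positivity)]
      linarith))
    (hqL.mono (by linarith)) hρL
    (fun x => by
      rw [← lineInt_avg hβ hr s x]
      simp only [lineInt, integral_neg, add_neg_cancel])
    (fun X hX => ?_) (fun X hX => ?_) hqt hG't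
  · refine ⟨G', hG', hG'm _ hρm, hG'L _ _ hρi, ?_, hrep.1⟩
    rw [hG't.integral_eq isCompact_cube hρ (by norm_num) hρL,
      hqt.integral_eq isCompact_cube hq (by linarith) hqL, hrep.2]
    ring
  · have h1 := hqG X
    have h2 := hlin (X - q X • ee j) (by rwa [h1]) (q X) 0 ((hqm X).trans (by nlinarith))
      (by simp; positivity)
    simpa using h2
  · have h1 : lineInt volume (ee i) q X ≠ 0 := fun h => hX (by simp [avg, h])
    obtain ⟨t, ht⟩ := lineInt_ne_zero h1
    have h2 := hqG (X + t • ee i)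
    have h3 := abs_sub (q (X + t • ee i)) (-avg β r s i q X)
    have h4 := hqm (X + t • ee i)
    have h5 := hρm X
    have h6 := hlin _ (by rwa [h2]) (q (X + t • ee i))
      (q (X + t • ee i) - -avg β r s i q X) (h4.trans (by nlinarith)) (h3.trans (by nlinarith))
    simp only [PiLp.sub_apply, PiLp.add_apply, PiLp.smul_apply, hj, ee_self, mul_zero, add_zero,
      smul_eq_mul, mul_one, sub_add_cancel, sub_sub_cancel] at h6
    rw [← h6]
    simp only [PiLp.proj_apply]
    congr 2
    ring

theorem exists_trade (hβ : IsKernel C β) (hij : i ≠ j) (hr : 0 < r)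
    (hU : cube p (12 * r) ⊆ U) (ha : a ≠ 0) (hu : ∀ x ∈ cube p (12 * r), u x = a * x i + c) :
    ∃ A δ, 0 ≤ A ∧ 0 < δ ∧ ∀ f M, SmoothIn (cube p r) f → M ≤ δ → (∀ x, |f x| ≤ M) →
      ∃ H, SmoothIn (cube (p + (3 * r) • ee i) r) H ∧ (∀ x, |H x| ≤ A * M) ∧
        DirLip (A * M) (ee i) H ∧ ∫ x, H x = ∫ x, f x ∧ Rep U u 4 (fun x => f x - H x) := by
  obtain ⟨D, P, χ, hD, hP, hχ, hPb, hPb', hχb, hχb', hχ1, hlin⟩ := exists_waves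
  obtain ⟨η₀, hη₀, hlevel⟩ := exists_level hij hr hU hu
  have hC := hβ.one_le
  have hU8 : cube p (8 * r) ⊆ U :=
    (cube_subset_cube fun k => by simp; linarith).trans hU
  set η := η₀ / D with hη
  have hη0 : 0 < η := by positivity
  have ha' : 0 < |a| := abs_pos.2 ha
  set κ := 1 / (16 * C) with hκ
  have hκ0 : 0 < κ := by positivity
  refine ⟨2 * (2 * C * D + 2 * (2 * C * D / r)), κ / 2 * (|a| * η) / D, by positivity,
    by positivity, fun f M hf hM hfM => ?_⟩
  have hM0 : 0 ≤ M := (abs_nonneg _).trans (hfM 0)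
  have hMD : M * D / (|a| * η) ≤ κ / 2 := by
    rw [div_le_iff₀ (by positivity), ← le_div_iff₀ (by positivity)]; exact hM
  obtain ⟨L, hL0, hL⟩ := (hf.pd isClosed_cube (ee j)).exists_bound isCompact_cube
  set k := max 1 (L * D / (κ / 2 * (|a| * η))) with hk
  have hk1 : 1 ≤ k := le_max_left _ _
  have hk0 : 0 < k := by linarith
  have hkL : L * D / (|a| * η * k) ≤ κ / 2 := by
    have : L * D / (κ / 2 * (|a| * η)) ≤ k := le_max_right _ _
    rw [div_le_iff₀ (by positivity)] at this ⊢
    linarith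
  set l := a * η * k with hl
  have hl0 : l ≠ 0 := by positivity
  have hlabs : |l| = |a| * η * k := by rw [hl, abs_mul, abs_mul, abs_of_pos hη0, abs_of_pos hk0]
  set m := M * D / |l| with hm
  have hm0 : 0 ≤ m := by positivity
  have hlm : |l| * m = M * D := by rw [hm]; field_simp
  have hkm : k * m ≤ κ / 2 := by
    rw [hm, hlabs]
    refine le_trans (le_of_eq ?_) hMD
    field_simp
  have hdl : ∀ (φ : ℝ → ℝ) (c t : ℝ), ContDiff ℝ (⊤ : ℕ∞) φ →
      deriv (fun t => c * φ (k * t)) t = c * (k * deriv φ (k * t)) := fun φ c t hφ => by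
    have h1 : HasDerivAt (fun t => k * t) k t := by
      simpa using (hasDerivAt_id t).const_mul k
    have h2 := ((hφ.differentiable (by simp) (k * t)).hasDerivAt.comp t h1).const_mul c
    rw [show (fun t => c * φ (k * t)) = fun y => c * (φ ∘ fun t => k * t) y from rfl, h2.deriv]
    ring
  have key : ∀ s, ∃ G', SmoothIn (cube (p + (3 * r) • ee i) r) G' ∧
      (∀ x, |G' x| ≤ 2 * C * D * M) ∧ DirLip (2 * (2 * C * D / r) * M) (ee i) G' ∧
      ∫ x, G' x = -∫ x, χ s (k * x j) * f x ∧
      Rep U u 2 (fun x => χ s (k * x j) * f x + G' x) := fun s => by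
    have hχs : ContDiff ℝ (⊤ : ℕ∞) (fun t => 1 / l * χ s (k * t)) :=
      contDiff_const.mul ((hχ s).comp (by fun_prop))
    have hσ : ContDiff ℝ (⊤ : ℕ∞) (fun t => η / k * P s (k * t)) :=
      contDiff_const.mul ((hP s).comp (by fun_prop))
    obtain ⟨Φ, hΦ, hΦu⟩ := hlevel _ hσ fun t _ => by
      rw [hdl _ _ _ (hP s)]
      constructor
      · rw [abs_mul, abs_of_pos (by positivity)]
        calc _ ≤ η / 1 * D := by gcongr; exact hPb s _
          _ = η₀ := by rw [hη]; field_simp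
      · rw [← mul_assoc, div_mul_cancel₀ _ hk0.ne', abs_mul, abs_of_pos hη0]
        calc _ ≤ η * D := by gcongr; exact hPb' s _
          _ = η₀ := by rw [hη]; field_simp
    have hV : Rep U u 1 (fun x => u (Φ x) - u (id x)) := rep_of_comp_sub hΦ isVolDiffeo_id
    have hG : SmoothIn (cube p r) (fun x => 1 / l * χ s (k * x j) * f x) :=
      ⟨contDiff_coord_mul hχs hf.smooth j, fun x hx => by rw [hf.eq_zero x hx, mul_zero]⟩
    have hGL : DirLip (1 / (16 * C)) (ee j) (fun x => 1 / l * χ s (k * x j) * f x) := by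
      refine dirLip_of_fderiv_le hG.smooth fun x => ?_
      change |pd _ _ _| ≤ _
      rw [pd_coord_mul hχs hf.smooth, hdl _ _ _ (hχ s), ee_self, mul_one]
      refine (abs_add_le _ _).trans ?_
      rw [abs_mul, abs_mul, abs_mul, abs_mul, abs_mul, abs_div, abs_one, hlabs, abs_of_pos hk0]
      calc _ ≤ 1 / (|a| * η * k) * (k * D) * M + 1 / (|a| * η * k) * D * L := by
            gcongr
            · exact hχb' s _
            · exact hfM x
            · exact hχb s _
            · exact hL x
        _ = M * D / (|a| * η) + L * D / (|a| * η * k) := by field_simp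
        _ ≤ 1 / (16 * C) := by linarith
    obtain ⟨G', h1, h2, h3, h4, h5⟩ := exists_average_tilt (m := m) (l := l)
      (w := fun t => a * (η * deriv (P s) (k * t))) hβ hij hr hU8
      (V := fun x => u (Φ x) - u (id x))
      (fun x hx => by
        rw [hΦu x hx, id, hu x (cube_subset_cube (fun k => by simp; linarith) hx),
          hdl _ _ _ (hP s), ← mul_assoc (η / k), div_mul_cancel₀ _ hk0.ne']
        ring)
      hG hGL
      (fun x => by
        rw [abs_mul, abs_mul, abs_div, abs_one, hm]
        calc _ ≤ 1 / |l| * D * M := by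
              gcongr
              · exact hχb s _
              · exact hfM x
          _ = _ := by ring)
      (fun X hX τ τ' hτ hτ' => by
        have hb : ∀ τ, |τ| ≤ 3 * C * m → |k * τ| ≤ 1 / 10 := fun τ hτ => by
          rw [abs_mul, abs_of_pos hk0]
          calc k * |τ| ≤ k * (3 * C * m) := by gcongr
            _ = 3 * C * (k * m) := by ring
            _ ≤ 3 * C * (κ / 2) := by gcongr
            _ = 3 / 32 := by rw [hκ]; field_simp; norm_num
            _ ≤ 1 / 10 := by norm_num
        have h := hlin s (k * X j) (k * τ) (k * τ') (fun h => hX (by simp [h])) (hb τ hτ)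
          (hb τ' hτ')
        rw [mul_add, mul_add, hl]
        linear_combination a * η * h)
    have hlG : (fun x => l * (1 / l * χ s (k * x j) * f x)) =
        fun x : Euc d => χ s (k * x j) * f x := by
      funext x
      field_simp
    have hlG' := fun x => congrFun hlG x
    simp only [hlG'] at h4 h5
    refine ⟨G', h1, fun x => (h2 x).trans (le_of_eq ?_), h3.mono (le_of_eq ?_), h4, hV.trans h5⟩
    · linear_combination 2 * C * hlm
    · linear_combination 4 * C / r * hlm
  choose G' h1 h2 h3 h4 h5 using key
  have hfint : ∀ s, Integrable (fun x : Euc d => χ s (k * x j) * f x) := fun s => by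
    have hs : SmoothIn (cube p r) (fun x : Euc d => χ s (k * x j) * f x) :=
      ⟨contDiff_coord_mul (σ := fun t => χ s (k * t)) ((hχ s).comp (by fun_prop)) hf.smooth j,
        fun x hx => by rw [hf.eq_zero x hx, mul_zero]⟩
    exact hs.smooth.continuous.integrable_of_hasCompactSupport (hs.hasCompactSupport isCompact_cube)
  have hfint' : ∀ s, Integrable (G' s) := fun s =>
    (h1 s).smooth.continuous.integrable_of_hasCompactSupport
      ((h1 s).hasCompactSupport isCompact_cube)
  refine ⟨fun x => -(G' 0 x + G' 1 x), ((h1 0).add (h1 1)).neg, fun x => ?_, ?_, ?_, ?_⟩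
  · rw [abs_neg]
    have := abs_add_le (G' 0 x) (G' 1 x)
    have : 0 ≤ 2 * (2 * C * D / r) * M := by positivity
    linarith [h2 0 x, h2 1 x]
  · have : 0 ≤ 2 * C * D * M := by positivity
    refine (DirLip.mono (κ := 2 * (2 * C * D / r) * M + 2 * (2 * C * D / r) * M)
      (fun x t => ?_) (by linarith)).neg
    have := abs_add_le (G' 0 (x + t • ee i) - G' 0 x) (G' 1 (x + t • ee i) - G' 1 x)
    rw [← add_sub_add_comm] at this
    have h6 := h3 0 x t
    have h7 := h3 1 x t
    change |G' 0 (x + t • ee i) + G' 1 (x + t • ee i) - (G' 0 x + G' 1 x)| ≤ _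
    linarith
  · rw [integral_neg, integral_add (hfint' 0) (hfint' 1), h4, h4, neg_add, neg_neg, neg_neg,
      ← integral_add (hfint 0) (hfint 1)]
    simp_rw [← add_mul, hχ1, one_mul]
  · have h6 := (h5 0).add (h5 1)
    convert h6 using 1
    funext x
    linear_combination -f x * hχ1 (k * x j)

end Wild

/-! ### Functions of small Lipschitz constant -/

section Product

variable {d : ℕ} {p c : Euc d} {r C : ℝ} {i : Fin d} {β : ℝ → ℝ} {J : Finset (Fin d)}
  {Q : Euc d → ℝ} {s : Fin d → ℝ}

/-- `Q` is the product of a fixed profile in the coordinates from `J` and a function of the other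
coordinates. -/
def HasProfile (β : ℝ → ℝ) (r : ℝ) (s : Fin d → ℝ) (J : Finset (Fin d)) (Q : Euc d → ℝ) : Prop :=
  ∃ D : Euc d → ℝ, (∀ k ∈ J, ∀ x (t : ℝ), D (x + t • ee k) = D x) ∧
    ∀ x, Q x = (∏ k ∈ J, β ((x k - s k) / r) / r) * D x

theorem HasProfile.neg (h : HasProfile β r s J Q) : HasProfile β r s J (fun x => -Q x) := by
  obtain ⟨D, h1, h2⟩ := h
  exact ⟨fun x => -D x, fun k hk x t => by simp only [h1 k hk],
    fun x => by simp only [h2]; ring⟩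

theorem HasProfile.avg (h : HasProfile β r s J Q) {k : Fin d} (hk : k ∉ J) :
    HasProfile β r s (insert k J) (avg β r (s k) k Q) := by
  obtain ⟨D, h1, h2⟩ := h
  refine ⟨lineInt volume (ee k) D, fun j hj x t => ?_, fun x => ?_⟩
  · rcases Finset.mem_insert.1 hj with rfl | hj
    · exact lineInt_add_smul _ _ _
    · simp only [lineInt]
      congr 1
      funext τ
      rw [add_right_comm, h1 j hj]
  · rw [Finset.prod_insert hk, VolFlex.avg, mul_assoc]
    congr 1
    rw [lineInt, lineInt, ← integral_const_mul]
    congr 1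
    funext t
    rw [h2]
    congr 1
    refine Finset.prod_congr rfl fun j hj => ?_
    have : j ≠ k := fun h => hk (h ▸ hj)
    simp [this]

theorem HasProfile.lineInt_eq_zero (hβ : IsKernel C β) (hr : 0 < r) (hQ : SmoothIn (cube c r) Q)
    (h : HasProfile β r s (Finset.univ.erase i) Q) (h0 : ∫ x, Q x = 0) (x : Euc d) :
    lineInt volume (ee i) Q x = 0 := by
  have h1 := h.avg (Finset.notMem_erase i _)
  rw [Finset.insert_erase (Finset.mem_univ i)] at h1
  have h2 := hQ.avg (k := i) hβ hr (s i)
  have h3 := integral_avg (k := i) hβ hr hQ (s i)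
  rw [h0] at h3
  rw [← lineInt_avg hβ hr (s i) x]
  set A := VolFlex.avg β r (s i) i Q with hA
  obtain ⟨D, hD, hAD⟩ := h1
  have hconst : ∀ x, D x = D 0 := fun x => by
    have h4 : ∀ T : Finset (Fin d), D (∑ k ∈ T, x k • ee k) = D 0 := fun T => by
      induction T using Finset.induction_on with
      | empty => simp
      | insert k T hk ih => rw [Finset.sum_insert hk, add_comm, hD k (Finset.mem_univ k), ih]
    have h5 : x = ∑ k, x k • ee k := by
      ext j
      simp [ee, Finset.sum_apply, Pi.single_apply]
    rw [h5]
    exact h4 _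
  have hB : ∀ x : Euc d, 0 ≤ ∏ k, β ((x k - s k) / r) / r := fun x =>
    Finset.prod_nonneg fun k _ => div_nonneg (hβ.nonneg _) hr.le
  have hpos : ∀ A' : Euc d → ℝ, SmoothIn (cube (c + (s i - c i) • ee i) r) A' →
      ∫ x, A' x = 0 → (∀ x, 0 ≤ A' x) → ∀ x, A' x = 0 := fun A' hA' hi hn x => by
    by_contra hx
    have := Continuous.integral_pos_of_hasCompactSupport_nonneg_nonzero (μ := volume)
      hA'.smooth.continuous (hA'.hasCompactSupport isCompact_cube) hn hx
    exact this.ne' hi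
  have hA0 : ∀ x, A x = 0 := by
    rcases le_total 0 (D 0) with h4 | h4
    · exact hpos A h2 h3 fun x => by rw [hAD, hconst]; exact mul_nonneg (hB x) h4
    · have := hpos _ h2.neg (by rw [integral_neg, h3, neg_zero]) fun x => by
        rw [hAD, hconst]
        exact neg_nonneg.2 (mul_nonpos_of_nonneg_of_nonpos (hB x) h4)
      exact fun x => neg_eq_zero.1 (this x)
  simp [lineInt, hA0]

end Product

section Tame

variable {d : ℕ} {U : Set (Euc d)} {p : Euc d} {r a c C μ : ℝ} {i j : Fin d} {u : Euc d → ℝ}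
  {β : ℝ → ℝ} {J : Finset (Fin d)} {H Q F : Euc d → ℝ}

/-- The centre of the cube containing the support after averaging over the directions in `J`. -/
noncomputable def centre (p : Euc d) (r : ℝ) (i : Fin d) (J : Finset (Fin d)) : Euc d :=
  p + (3 * r) • ee i + ∑ k ∈ J, (3 * r) • ee k

theorem centre_apply (hi : i ∉ J) (k : Fin d) :
    centre p r i J k = p k + if k = i ∨ k ∈ J then 3 * r else 0 := by
  have h1 : (∑ k ∈ J, (3 * r) • (ee k : Euc d)) k = if k ∈ J then 3 * r else 0 := by
    simp [ee, Finset.sum_apply, Pi.single_apply]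
  rw [centre, PiLp.add_apply, h1]
  by_cases hk : k = i
  · subst hk; simp [hi]
  · simp [hk]

theorem centre_insert {k : Fin d} (hk : k ∉ J) :
    centre p r i (insert k J) = centre p r i J + (3 * r) • ee k := by
  rw [centre, centre, Finset.sum_insert hk]
  abel

theorem cube_centre_subset (hr : 0 < r) (hi : i ∉ J) : cube (centre p r i J) r ⊆ cube p (8 * r) :=
  cube_subset_cube fun k => by
    rw [centre_apply hi, add_sub_cancel_left]
    split_ifs
    · rw [abs_of_pos (by positivity)]; linarith
    · rw [abs_zero]; linarith

/-- The state after averaging over the directions in `J`. -/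
structure IsStage (U : Set (Euc d)) (u : Euc d → ℝ) (p : Euc d) (r a C μ : ℝ) (i : Fin d)
    (β : ℝ → ℝ) (H : Euc d → ℝ) (J : Finset (Fin d)) (Q F : Euc d → ℝ) : Prop where
  smoothIn : SmoothIn (cube (centre p r i J) r) Q
  tilt : IsTilt (ee i) a Q F
  bound : ∀ x, |Q x| ≤ (2 * C) ^ J.card * μ
  lip : DirLip ((2 * C) ^ J.card * μ) (ee i) Q
  integral : ∫ x, Q x = 0
  profile : HasProfile β r (fun k => p k + 3 * r) J Q
  rep : ∀ N, Rep U u N F → Rep U u (N + J.card) H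

theorem IsStage.insert (hβ : IsKernel C β) (hr : 0 < r) (hU : cube p (8 * r) ⊆ U)
    (hu : ∀ x ∈ cube p (8 * r), u x = a * x i + c) (hμ : (2 * C) ^ d * μ ≤ 1 / 2) (hμ0 : 0 ≤ μ)
    {k : Fin d} (hk : k ∉ J) (hki : k ≠ i) (hi : i ∉ J) (h : IsStage U u p r a C μ i β H J Q F) :
    ∃ F', IsStage U u p r a C μ i β H (insert k J) (fun x => -avg β r (p k + 3 * r) k Q x) F' := by
  have hC := hβ.one_le
  have hsmall : ∀ T : Finset (Fin d), (2 * C) ^ T.card * μ ≤ 1 / 2 := fun T => by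
    refine le_trans ?_ hμ
    gcongr
    · linarith
    · simpa using Finset.card_le_univ T
  have hcard : (2 * C) ^ (Insert.insert k J).card * μ = 2 * C * ((2 * C) ^ J.card * μ) := by
    rw [Finset.card_insert_of_notMem hk, pow_succ]; ring
  have hik : (ee i : Euc d) k = 0 := ee_of_ne hki
  have hki' : (ee k : Euc d) i = 0 := ee_of_ne hki.symm
  have hck : centre p r i J k = p k := by rw [centre_apply hi]; simp [hki, hk]
  have hq : SmoothIn (cube (centre p r i (Insert.insert k J)) r)
      (fun x => -avg β r (p k + 3 * r) k Q x) := by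
    have := (h.smoothIn.avg (k := k) hβ hr (p k + 3 * r)).neg
    rwa [hck, add_sub_cancel_left, ← centre_insert hk] at this
  have hqL : DirLip ((2 * C) ^ (Insert.insert k J).card * μ) (ee i)
      (fun x => -avg β r (p k + 3 * r) k Q x) := by
    rw [hcard]
    exact (dirLip_avg hβ hr h.smoothIn _ hik h.lip).neg
  obtain ⟨F', hF', -, -, -⟩ := exists_tilt hq (hsmall _) hqL a
  have hi' : i ∉ Insert.insert k J := by simp [hi, hki.symm]
  have hrep := IsTilt.rep_add (u := u) (w := fun t => a * t + c) (U := U) (b := ee k)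
    (ℓ := (EuclideanSpace.proj i : Euc d →L[ℝ] ℝ)) isCompact_cube convex_cube hU (ee_ne_zero k)
    (by simp) (by simpa using hki') hu (h.smoothIn.mono (cube_centre_subset hr hi))
    (hq.mono (cube_centre_subset hr hi'))
    (lineDisjoint_of_coord h.smoothIn hq hik (by
      rw [centre_insert hk]
      simp only [PiLp.add_apply, PiLp.smul_apply, ee_self, smul_eq_mul, mul_one,
        sub_add_cancel_left, abs_neg]
      rw [abs_of_pos (by positivity)]
      linarith))
    (h.lip.mono (hsmall _)) (hqL.mono (hsmall _))
    (fun x => by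
      rw [← lineInt_avg hβ hr (p k + 3 * r) x]
      simp only [lineInt, integral_neg, add_neg_cancel])
    (fun X _ => by ring) (fun X _ => by ring) h.tilt hF'
  refine ⟨F', hq, hF', fun x => ?_, hqL, ?_, (h.profile.avg hk).neg, fun N hN => ?_⟩
  · rw [hcard, abs_neg]
    exact abs_avg_le hβ hr h.smoothIn _ h.bound x
  · have := hrep.2
    rw [h.integral] at this
    linarith
  · rw [Finset.card_insert_of_notMem hk, ← add_assoc, add_right_comm]
    refine h.rep _ ?_
    rw [add_comm N]
    simpa using hrep.1.sub hN

theorem exists_isStage (hβ : IsKernel C β) (hr : 0 < r) (hU : cube p (8 * r) ⊆ U)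
    (hu : ∀ x ∈ cube p (8 * r), u x = a * x i + c) (hμ : (2 * C) ^ d * μ ≤ 1 / 2) (hμ0 : 0 ≤ μ)
    (h : ∃ Q F, IsStage U u p r a C μ i β H ∅ Q F) (hi : i ∉ J) :
    ∃ Q F, IsStage U u p r a C μ i β H J Q F := by
  induction J using Finset.induction_on with
  | empty => exact h
  | insert k J hk ih =>
    rw [Finset.mem_insert, not_or] at hi
    obtain ⟨Q, F, hQ⟩ := ih hi.2
    obtain ⟨F', hF'⟩ := hQ.insert hβ hr hU hu hμ hμ0 hk (Ne.symm hi.1) hi.2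
    exact ⟨_, F', hF'⟩

theorem exists_rep_of_lineInt_eq_zero (hij : i ≠ j) (hr : 0 < r) (hU : cube p (12 * r) ⊆ U)
    (hu : ∀ x ∈ cube p (12 * r), u x = a * x i + c) :
    ∃ ε > 0, ∀ Q F J, i ∉ J → SmoothIn (cube (centre p r i J) r) Q → DirLip (1 / 2) (ee i) Q →
      DirLip ε (ee j) Q → (∀ x, lineInt volume (ee i) Q x = 0) → IsTilt (ee i) a Q F →
      Rep U u 2 F := by
  obtain ⟨η, hη, hlevel⟩ := exists_level hij hr hU hu
  have h8 : cube p (8 * r) ⊆ cube p (12 * r) := cube_subset_cube fun k => by simp; linarith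
  have hU8 := h8.trans hU
  set ε := min 1 (η / (72 * r ^ 2 + 12 * r)) with hε
  have hε0 : 0 < ε := by positivity
  have hε1 : ε ≤ 1 := min_le_left _ _
  have hεη : ε * (72 * r ^ 2 + 12 * r) ≤ η := by
    rw [← le_div_iff₀ (by positivity)]; exact min_le_right _ _
  have hσ : ContDiff ℝ (⊤ : ℕ∞) (fun t : ℝ => ε / 2 * (t - p j) ^ 2) := by fun_prop
  have hσd : ∀ t, deriv (fun t : ℝ => ε / 2 * (t - p j) ^ 2) t = ε * (t - p j) := fun t => by
    have := ((((hasDerivAt_id t).sub_const (p j)).pow 2).const_mul (ε / 2)).deriv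
    simp only [id, Pi.pow_apply] at this
    refine Eq.trans ?_ (this.trans (by simp; ring))
    rfl
  obtain ⟨Φ, hΦ, hΦu⟩ := hlevel _ hσ fun t ht => by
    rw [hσd]
    constructor
    · rw [abs_mul, abs_pow, abs_of_pos (by positivity)]
      calc _ ≤ ε / 2 * (12 * r) ^ 2 := by gcongr
        _ ≤ η := by nlinarith [mul_pos hε0 hr]
    · rw [abs_mul, abs_of_pos hε0]
      calc _ ≤ ε * (12 * r) := by gcongr
        _ ≤ η := by nlinarith [mul_pos hε0 (pow_pos hr 2)]
  refine ⟨ε / 2, by positivity, fun Q F J hJ hQ hQi hQj h0 hF => ?_⟩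
  have hji : (ee j : Euc d) i = 0 := ee_of_ne hij
  have hij' : (ee i : Euc d) j = 0 := ee_of_ne hij.symm
  set b : Euc d := ε • ee i - ee j with hb
  have hbj : b j = -1 := by simp [hb, hij.symm]
  have hbi : b i = ε := by simp [hb, hij]
  have hbk : ∀ k, k ≠ i → k ≠ j → b k = 0 := fun k h1 h2 => by simp [hb, h1, h2]
  have hb0 : b ≠ 0 := fun h => by
    rw [h] at hbj; simp at hbj
  have hQε : SmoothIn (cube (centre p r i J) r) (fun x => 1 / ε * Q x) :=
    ⟨contDiff_const.mul hQ.smooth, fun x hx => by rw [hQ.eq_zero x hx, mul_zero]⟩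
  obtain ⟨R, hR, hRi⟩ := exists_primitive hQε isCompact_cube convex_cube (ee_ne_zero i)
    (fun x => by
      have := h0 x
      rw [lineInt] at this ⊢
      rw [integral_const_mul, this, mul_zero])
  have hRj := hR.pd isClosed_cube (ee j)
  set q : Euc d → ℝ := fun x => -pd R (ee j) (x + (3 * r) • b) with hq
  have hqs : SmoothIn (cube (centre p r i J - (3 * r) • b) r) q := by
    refine ⟨(hRj.smooth.comp (by fun_prop : ContDiff ℝ (⊤ : ℕ∞) fun x => x + (3 * r) • b)).neg,
      fun x hx => ?_⟩
    rw [hq]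
    refine neg_eq_zero.2 (hRj.eq_zero _ fun hm => hx fun k => ?_)
    have := hm k
    rw [PiLp.add_apply] at this
    rw [PiLp.sub_apply]
    convert this using 2
    ring
  have hqL : DirLip (1 / 2) (ee i) q := by
    refine ((dirLip_of_fderiv_le hRj.smooth fun x => ?_).comp_add_right _).neg
    rw [pd_comm hR.smooth, show pd R (ee i) = _ from funext hRi]
    have h1 := hQj.const_mul (1 / ε)
    refine (h1.abs_fderiv_le hQε.smooth x).trans (le_of_eq ?_)
    rw [abs_of_pos (by positivity)]
    field_simp
  obtain ⟨F', hF', -, -, -⟩ := exists_tilt hqs le_rfl hqL a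
  have hsub : cube (centre p r i J - (3 * r) • b) r ⊆ cube p (8 * r) := cube_subset_cube fun k => by
    rw [PiLp.sub_apply, PiLp.smul_apply, centre_apply hJ, smul_eq_mul]
    have h1 : |(p k + if k = i ∨ k ∈ J then 3 * r else 0) - 3 * r * b k - p k| ≤ 6 * r := by
      have h2 : |b k| ≤ 1 := by
        by_cases h2 : k = i
        · rw [h2, hbi, abs_of_pos hε0]; exact hε1
        · by_cases h3 : k = j
          · rw [h3, hbj]; simp
          · rw [hbk k h2 h3]; simp
      have h3 : |(3 * r * b k)| ≤ 3 * r := by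
        rw [abs_mul, abs_of_pos (by positivity)]; nlinarith
      rw [abs_le] at h3 ⊢
      split_ifs <;> constructor <;> linarith
    linarith
  have hproj : ∀ k v, (EuclideanSpace.proj k : Euc d →L[ℝ] ℝ) v = v k := fun k v => rfl
  have h1 := IsTilt.rep_add (u := fun x => u (Φ x)) (w := fun t => a * (t - ε * p j) + c) (U := U)
    (b := b) (ℓ := (EuclideanSpace.proj i : Euc d →L[ℝ] ℝ) + ε • EuclideanSpace.proj j)
    (K := cube p (8 * r)) (a := ee i) (l := a)
    isCompact_cube convex_cube hU8 hb0 (by simp [hproj, hij.symm]) (by simp [hproj, hbi, hbj])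
    (fun x hx => by
      rw [hΦu x hx, hσd]
      simp only [add_apply, smul_apply, hproj, smul_eq_mul]
      ring)
    (hQ.mono (cube_centre_subset hr hJ)) (hqs.mono hsub)
    (lineDisjoint_of_coord (k := j) hQ hqs hij' (by
      rw [PiLp.sub_apply, PiLp.smul_apply, hbj, sub_sub_cancel, smul_eq_mul, mul_neg, abs_neg,
        mul_one, abs_of_pos (by positivity)]
      linarith)) hQi hqL
    (fun x => by
      have h1 : lineInt volume b q x = -lineInt volume b (pd R (ee j)) x := by
        have h2 := lineInt_add_smul (g := pd R (ee j)) b x (3 * r)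
        rw [← h2, lineInt, lineInt, ← integral_neg]
        simp only [hq, add_right_comm x]
      have h2 : ∀ y, pd R b y = Q y - pd R (ee j) y := fun y => by
        have h3 := hRi y
        rw [pd] at h3
        rw [pd, pd, hb, map_sub, map_smul, h3, smul_eq_mul]
        field_simp
      have h3 := lineInt_pd_self hR isCompact_cube hb0 x
      rw [show pd R b = _ from funext h2, lineInt, integral_sub
        (integrable_line hQ isCompact_cube hb0 x _)
        (integrable_line hRj isCompact_cube hb0 x _)] at h3
      rw [h1]
      exact (sub_eq_add_neg _ _).symm.trans h3)
    (fun X _ => by ring) (fun X _ => by ring) hF hF'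
  have h2 : Rep U u 1 F' := IsTilt.rep (w := fun t => a * t + c)
    (ℓ := (EuclideanSpace.proj i : Euc d →L[ℝ] ℝ)) (b := ee j)
    isCompact_cube convex_cube hU8 (ee_ne_zero j) (by simp) (by simpa using hji)
    (fun x hx => hu x (h8 hx)) (hqs.mono hsub) hqL
    (fun x => by
      have h2 := lineInt_pd_self hR isCompact_cube (ee_ne_zero j) (x + (3 * r) • b)
      rw [lineInt] at h2
      simp only [lineInt, hq, integral_neg, add_right_comm x _ ((3 * r) • b), h2, neg_zero])
    (fun X _ => by ring) hF'
  simpa using (Rep.of_comp hΦ h1.1).sub h2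

theorem exists_rep_of_dirLip (hβ : IsKernel C β) (hij : i ≠ j) (hr : 0 < r)
    (hU : cube p (12 * r) ⊆ U) (ha : a ≠ 0) (hu : ∀ x ∈ cube p (12 * r), u x = a * x i + c) :
    ∃ δ > 0, ∀ H, SmoothIn (cube (p + (3 * r) • ee i) r) H → (∀ x, |H x| ≤ δ) →
      DirLip δ (ee i) H → ∫ x, H x = 0 → Rep U u (d + 2) H := by
  obtain ⟨ε, hε, hend⟩ := exists_rep_of_lineInt_eq_zero hij hr hU hu
  have hC := hβ.one_le
  have h8 : cube p (8 * r) ⊆ cube p (12 * r) := cube_subset_cube fun k => by simp; linarith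
  have hU8 := h8.trans hU
  set μ := min (1 / 2) (ε * r / (2 * C)) / (2 * C) ^ d with hμ
  have hμ0 : 0 < μ := by positivity
  have hμd : (2 * C) ^ d * μ = min (1 / 2) (ε * r / (2 * C)) := by rw [hμ]; field_simp
  have hμ1 : (2 * C) ^ d * μ ≤ 1 / 2 := by rw [hμd]; exact min_le_left _ _
  have hsmall : ∀ T : Finset (Fin d), (2 * C) ^ T.card * μ ≤ (2 * C) ^ d * μ := fun T => by
    gcongr
    · linarith
    · simpa using Finset.card_le_univ T
  have hμ2 : μ ≤ 1 / 2 := by simpa using (hsmall ∅).trans hμ1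
  have ha' := abs_pos.2 ha
  refine ⟨|a| * μ / 2, by positivity, fun H hH hHb hHL hH0 => ?_⟩
  have hG : SmoothIn (cube (p + (3 * r) • ee i) r) (fun x => 1 / a * H x) :=
    ⟨contDiff_const.mul hH.smooth, fun x hx => by rw [hH.eq_zero x hx, mul_zero]⟩
  have hGL : DirLip (μ / 2) (ee i) (fun x => 1 / a * H x) :=
    (hHL.const_mul (1 / a)).mono (le_of_eq (by
      rw [abs_div, abs_one]; field_simp))
  have hGb : ∀ x, |1 / a * H x| ≤ μ := fun x => by
    rw [abs_mul, abs_div, abs_one]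
    calc _ ≤ 1 / |a| * (|a| * μ / 2) := by gcongr; exact hHb x
      _ = μ / 2 := by field_simp
      _ ≤ μ := by linarith
  obtain ⟨Q₀, ht, hs, hL, hb, -⟩ := exists_untilt hG (by linarith) hGL a
  have hL' := hL _ _ hGL
  rw [mul_div_cancel₀ μ two_ne_zero] at hL'
  have hfun : (fun x => a * (1 / a * H x)) = H := by funext x; field_simp
  rw [hfun] at ht
  have h0 : ∃ Q F, IsStage U u p r a C μ i β H ∅ Q F := by
    refine ⟨Q₀, H, by simpa [centre] using hs, ht, by simpa using hb μ hGb, by simpa using hL', ?_,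
      ⟨Q₀, by simp, by simp⟩, fun N hN => by simpa using hN⟩
    have := ht.integral_eq isCompact_cube hs (by linarith) hL'
    rw [hH0, eq_comm, mul_eq_zero] at this
    exact this.resolve_left ha
  set J := (Finset.univ.erase i).erase j with hJ
  have hiJ : i ∉ J := by simp [hJ]
  obtain ⟨Q, F, hQ⟩ := exists_isStage hβ hr hU8 (fun x hx => hu x (h8 hx)) hμ1 hμ0.le h0 hiJ
  obtain ⟨F', hF'⟩ := hQ.insert hβ hr hU8 (fun x hx => hu x (h8 hx)) hμ1 hμ0.le
    (Finset.notMem_erase j _) hij.symm hiJ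
  have hins : insert j J = Finset.univ.erase i :=
    Finset.insert_erase (by simp [hij.symm])
  rw [← hJ, hins] at hF'
  have h1 := hend _ F' _ (Finset.notMem_erase i _) hF'.smoothIn
    (hF'.lip.mono ((hsmall _).trans hμ1))
    (((dirLip_avg_self hβ hr hQ.smoothIn _ hQ.bound).mono (by
      have h2 : (2 * C) ^ J.card * μ ≤ ε * r / (2 * C) :=
        (hsmall J).trans (hμd.le.trans (min_le_right _ _))
      rw [div_le_iff₀ hr]
      rw [le_div_iff₀ (by positivity)] at h2
      linarith)).neg)
    (hF'.profile.lineInt_eq_zero hβ hr hF'.smoothIn hF'.integral) hF'.tilt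
  refine (hF'.rep 2 h1).mono ?_
  have := Finset.card_le_univ (Finset.univ.erase i)
  rw [Fintype.card_fin] at this
  omega

end Tame

/-! ### The local theorem -/

section Local

variable {d : ℕ} {U V : Set (Euc d)} {p : Euc d} {r a c : ℝ} {i j : Fin d} {u : Euc d → ℝ}

variable (U) in
/-- Bounded functions of mean zero supported in `V` are representable, with a number of terms
depending only on the bound. -/
def LocalRep (u : Euc d → ℝ) (V : Set (Euc d)) : Prop :=
  ∀ A : ℝ, ∃ N : ℕ, ∀ f, SmoothIn V f → (∀ x, |f x| ≤ A) → ∫ x, f x = 0 → Rep U u N f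

theorem LocalRep.mono {V' : Set (Euc d)} (h : LocalRep U u V) (hV : V' ⊆ V) : LocalRep U u V' :=
  fun A => (h A).imp fun _ hN f hf => hN f (hf.mono hV)

theorem LocalRep.of_comp {Θ : Euc d → Euc d} (hΘ : IsVolDiffeoSuppIn d U Θ)
    (h : LocalRep U (fun x => u (Θ x)) V) : LocalRep U u V :=
  fun A => (h A).imp fun _ hN f hf hA h0 => (hN f hf hA h0).of_comp hΘ

theorem localRep_of_small {δ : ℝ} {N : ℕ} (hδ : 0 < δ)
    (h : ∀ f, SmoothIn V f → (∀ x, |f x| ≤ δ) → ∫ x, f x = 0 → Rep U u N f) :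
    LocalRep U u V := by
  intro A
  obtain ⟨m, hm⟩ := exists_nat_ge (A / δ)
  have hm1 : (0 : ℝ) < (m + 1 : ℕ) := by positivity
  refine ⟨∑ _k ∈ Finset.range (m + 1), N, fun f hf hA h0 => ?_⟩
  have h1 : Rep U u N (fun x => 1 / (m + 1 : ℕ) * f x) := by
    refine h _ ⟨contDiff_const.mul hf.smooth, fun x hx => by rw [hf.eq_zero x hx, mul_zero]⟩
      (fun x => ?_) (by rw [integral_const_mul, h0, mul_zero])
    rw [abs_mul, abs_of_pos (by positivity), one_div_mul_eq_div, div_le_iff₀ hm1]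
    rw [div_le_iff₀ hδ] at hm
    push_cast
    nlinarith [hA x]
  have h2 := Rep.sum (Finset.range (m + 1)) (n := fun _ => N) fun _ _ => h1
  convert h2 using 2 with x
  rw [Finset.sum_const, Finset.card_range, nsmul_eq_mul]
  field_simp

theorem localRep_of_affine (hij : i ≠ j) (hr : 0 < r) (hU : cube p (12 * r) ⊆ U) (ha : a ≠ 0)
    (hu : ∀ x ∈ cube p (12 * r), u x = a * x i + c) : LocalRep U u (cube p r) := by
  obtain ⟨C, β, hβ⟩ := exists_isKernel
  obtain ⟨A, δ₁, hA, hδ₁, htrade⟩ := exists_trade hβ hij hr hU ha hu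
  obtain ⟨δ₂, hδ₂, hrep⟩ := exists_rep_of_dirLip hβ hij hr hU ha hu
  have hsmall : A * min δ₁ (δ₂ / (A + 1)) ≤ δ₂ := by
    calc A * min δ₁ (δ₂ / (A + 1)) ≤ (A + 1) * (δ₂ / (A + 1)) := by
          gcongr
          · linarith
          · exact min_le_right _ _
      _ = δ₂ := by field_simp
  refine localRep_of_small (δ := min δ₁ (δ₂ / (A + 1))) (N := (d + 2) + 4) (by positivity)
    fun f hf hb h0 => ?_
  obtain ⟨H, hH, hHb, hHL, hHint, hR⟩ := htrade f _ hf (min_le_left _ _) hb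
  simpa using (hrep H hH (fun x => (hHb x).trans hsmall) (hHL.mono hsmall) (hHint.trans h0)).add hR

/-- A smooth function vanishing to first order at `p` has the germ of a compactly supported
function of small Lipschitz constant. -/
theorem exists_dirLip_germ {h : Euc d → ℝ} (hh : ContDiff ℝ (⊤ : ℕ∞) h) (h0 : h p = 0)
    (h1 : fderiv ℝ h p = 0) (hV : V ∈ nhds p) {κ : ℝ} (hκ : 0 < κ) (i : Fin d) :
    ∃ ρ > 0, cube p (4 * ρ) ⊆ V ∧ ∃ m, SmoothIn (cube p ρ) m ∧
      (∀ x ∈ cube p (ρ / 2), m x = h x) ∧ DirLip κ (ee i) m := by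
  obtain ⟨ψ, hψ, hψ1, hψ01⟩ := exists_cutoff (d := d) (K := cube 0 (1 / 2))
    (V := interior (cube 0 1)) isClosed_cube isOpen_interior fun x hx => by
      refine mem_interior_iff_mem_nhds.2 (Filter.mem_of_superset
        (cube_mem_nhds (c := x) (r := 1 / 2) (by norm_num)) (cube_subset_cube fun k => ?_))
      linarith [hx k]
  replace hψ := hψ.mono interior_subset
  obtain ⟨D, hD0, hD⟩ := (hψ.pd isClosed_cube (ee i)).exists_bound isCompact_cube
  set L := ‖(ee i : Euc d)‖ + d * D + 1 with hL
  have hL0 : 0 < L := by positivity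
  have hfd : Continuous (fderiv ℝ h) := (hh.fderiv_right (m := (⊤ : ℕ∞)) (by simp)).continuous
  have hev : ∀ᶠ x in nhds p, ‖fderiv ℝ h x‖ < κ / L := by
    refine hfd.norm.continuousAt.eventually_lt continuousAt_const ?_
    rw [h1, norm_zero]
    positivity
  obtain ⟨W, hW, hWo, hpW⟩ := mem_nhds_iff.1 (Filter.inter_mem hev hV)
  obtain ⟨ρ', hρ', hcube⟩ := exists_cube_subset hWo hpW
  set ρ := ρ' / 4 with hρ
  have hρ0 : 0 < ρ := by positivity
  have h4 : 4 * ρ = ρ' := by rw [hρ]; ring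
  have hmem : ∀ t, ρ⁻¹ • (t - p) ∈ cube (0 : Euc d) 1 ↔ t ∈ cube p ρ := fun t => by
    refine forall_congr' fun k => ?_
    rw [PiLp.smul_apply, PiLp.sub_apply, PiLp.zero_apply, sub_zero, smul_eq_mul, abs_mul,
      abs_of_pos (by positivity), inv_mul_le_iff₀ hρ0, mul_one]
  refine ⟨ρ, hρ0, ?_, fun x => h x * ψ (ρ⁻¹ • (x - p)), ⟨?_, fun x hx => ?_⟩, fun x hx => ?_, ?_⟩
  · rw [h4]
    exact fun x hx => (hW (hcube hx)).2
  · exact hh.mul (hψ.smooth.comp (by fun_prop))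
  · rw [hψ.eq_zero _ fun hx' => hx ((hmem x).1 hx'), mul_zero]
  · change h x * ψ _ = h x
    rw [hψ1, mul_one]
    intro k
    rw [PiLp.smul_apply, PiLp.sub_apply, PiLp.zero_apply, sub_zero, smul_eq_mul, abs_mul,
      abs_of_pos (by positivity), inv_mul_le_iff₀ hρ0]
    linarith [hx k]
  · refine dirLip_of_fderiv_le (hh.mul (hψ.smooth.comp (by fun_prop))) fun x => ?_
    have e1 : HasFDerivAt (fun x : Euc d => ρ⁻¹ • (x - p)) (ρ⁻¹ • ContinuousLinearMap.id ℝ _) x :=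
      ((hasFDerivAt_id x).sub_const p).const_smul ρ⁻¹
    have e2 := (hψ.smooth.differentiable (by simp) (ρ⁻¹ • (x - p))).hasFDerivAt.comp x e1
    have e3 := (hh.differentiable (by simp) x).hasFDerivAt.mul e2
    have e4 : fderiv ℝ (fun x => h x * ψ (ρ⁻¹ • (x - p))) x (ee i)
        = h x * (ρ⁻¹ * pd ψ (ee i) (ρ⁻¹ • (x - p)))
          + ψ (ρ⁻¹ • (x - p)) * fderiv ℝ h x (ee i) := by
      rw [(show HasFDerivAt (fun x => h x * ψ (ρ⁻¹ • (x - p))) _ x from e3).fderiv]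
      simp [pd]
    refine (congrArg abs e4).trans_le ?_
    by_cases hx : x ∈ cube p ρ
    · have hc : ∀ y ∈ cube p ρ, ‖fderiv ℝ h y‖ ≤ κ / L := fun y hy =>
        (hW (hcube (cube_subset_cube (fun k => by simp; linarith) hy))).1.le
      have b1 : |h x| ≤ κ / L * (d * ρ) := by
        have := convex_cube.norm_image_sub_le_of_norm_fderiv_le
          (fun y _ => hh.differentiable (by simp) y) hc (mem_cube_self hρ0.le) hx
        rw [h0, sub_zero] at this
        refine this.trans ?_
        gcongr
        rw [← dist_eq_norm]
        exact cube_subset_closedBall hx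
      have b2 : |fderiv ℝ h x (ee i)| ≤ κ / L * ‖(ee i : Euc d)‖ :=
        ((fderiv ℝ h x).le_opNorm _).trans (by gcongr; exact hc x hx)
      have b3 : |ψ (ρ⁻¹ • (x - p))| ≤ 1 := by
        rw [abs_of_nonneg (hψ01 _).1]; exact (hψ01 _).2
      calc _ ≤ |h x| * (ρ⁻¹ * |pd ψ (ee i) (ρ⁻¹ • (x - p))|)
            + |ψ (ρ⁻¹ • (x - p))| * |fderiv ℝ h x (ee i)| := by
            refine (abs_add_le _ _).trans (le_of_eq ?_)
            rw [abs_mul, abs_mul, abs_mul, abs_of_pos (inv_pos.2 hρ0)]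
        _ ≤ κ / L * (d * ρ) * (ρ⁻¹ * D) + 1 * (κ / L * ‖(ee i : Euc d)‖) := by
            gcongr
            exact hD _
        _ = κ * ((d * D + ‖(ee i : Euc d)‖) / L) := by field_simp
        _ ≤ κ * 1 := by
            gcongr
            rw [div_le_one hL0]
            linarith
        _ = κ := mul_one κ
    · have h2 := fun hx' => hx ((hmem x).1 hx')
      rw [hψ.eq_zero _ h2, (hψ.pd isClosed_cube (ee i)).eq_zero _ h2]
      simpa using hκ.le

/-- Near a regular point, `u` is affine in suitable volume preserving coordinates. -/
theorem exists_straightening (hij : i ≠ j) (hU : IsOpen U) (hp : p ∈ U)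
    (hu : ContDiff ℝ (⊤ : ℕ∞) u) (ha : a ≠ 0) (hfd : ∀ v, fderiv ℝ u p v = a * v i) :
    ∃ Θ c, IsVolDiffeoSuppIn d U Θ ∧ ∀ᶠ x in nhds p, u x = a * Θ x i + c := by
  obtain ⟨C, β, hβ⟩ := exists_isKernel
  have hC := hβ.one_le
  set h : Euc d → ℝ := fun x => (u x - u p) / a - (x i - p i) with hh
  have hhs : ContDiff ℝ (⊤ : ℕ∞) h := by
    refine ((hu.sub contDiff_const).div_const a).sub (ContDiff.sub ?_ contDiff_const)
    fun_prop
  have hfdh : fderiv ℝ h p = 0 := by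
    have e1 : HasFDerivAt (fun x : Euc d => x i - p i) (EuclideanSpace.proj i : Euc d →L[ℝ] ℝ) p :=
      (EuclideanSpace.proj i : Euc d →L[ℝ] ℝ).hasFDerivAt.sub_const _
    have e2 := (((hu.differentiable (by simp) p).hasFDerivAt.sub_const (u p)).mul_const a⁻¹).sub e1
    have e3 : fderiv ℝ h p = _ := (show HasFDerivAt h _ p from e2).fderiv
    rw [e3]
    ext v
    simp [hfd]
    field_simp
    simp
  obtain ⟨ρ, hρ, hsub, m, hm, hmh, hmL⟩ := exists_dirLip_germ hhs (by simp [hh]) hfdh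
    (hU.mem_nhds hp) (κ := 1 / (16 * C)) (by positivity) i
  have hκ : 1 / (16 * C) ≤ 1 / 16 := by
    rw [div_le_div_iff₀ (by positivity) (by norm_num)]; linarith
  obtain ⟨g, hg, hgd, hgL, -⟩ := exists_isDual_smoothIn hm (by linarith) hmL
  have hgL' : DirLip (2 * (1 / (16 * C))) (ee i) g := hgL _ _ hmL
  have hav := hg.avg (k := j) hβ hρ (p j + 3 * ρ)
  rw [add_sub_cancel_left] at hav
  have hq : SmoothIn (cube p (4 * ρ)) (fun x => g x + -avg β ρ (p j + 3 * ρ) j g x) := by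
    refine (hg.mono (cube_subset_cube fun k => ?_)).add
      (hav.neg.mono (cube_subset_cube fun k => ?_))
    · simp; linarith
    · rcases eq_or_ne k j with rfl | hk
      · simp [abs_of_pos hρ]; linarith
      · simp [hk]; linarith
  obtain ⟨S, hS, hSj⟩ := exists_primitive hq isCompact_cube convex_cube (ee_ne_zero j) fun x => by
    have h1 := lineInt_avg (k := j) (g := g) hβ hρ (p j + 3 * ρ) x
    rw [lineInt] at h1 ⊢
    rw [integral_add (integrable_line hg isCompact_cube (ee_ne_zero j) x _)
      (integrable_line hav.neg isCompact_cube (ee_ne_zero j) x _), integral_neg, h1, lineInt,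
      add_neg_cancel]
  have hL : DirLip (1 / 2) (ee i) (pd S (ee j)) := by
    rw [show pd S (ee j) = _ from funext hSj]
    have h1 := dirLip_avg (k := j) hβ hρ hg (p j + 3 * ρ) (ee_of_ne hij.symm) hgL'
    intro x t
    have h2 := hgL' x t
    have h3 := h1 x t
    rw [abs_le] at h2 h3
    have h4 : 2 * (1 / (16 * C)) * |t| ≤ 1 / 8 * |t| := by gcongr; linarith
    have h5 : 2 * C * (2 * (1 / (16 * C))) * |t| = 1 / 4 * |t| := by field_simp; ring
    rw [abs_le]
    constructor <;> linarith [abs_nonneg t]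
  obtain ⟨Θ, hΘ, hΘX⟩ := exists_generated isCompact_cube hsub hS.smooth hS.eq_zero hL
  refine ⟨Θ, u p - a * p i, hΘ, ?_⟩
  filter_upwards [cube_mem_nhds (c := p) (half_pos hρ)] with y hy
  have hyρ : y ∈ cube p ρ := cube_subset_cube (fun k => by simp; linarith) hy
  set X := y + m y • (ee i : Euc d) with hX
  have hgX : g X = -m y := hgd.left y
  have hXρ : X ∈ cube p ρ := by
    by_contra hX'
    rw [hg.eq_zero X hX', zero_eq_neg] at hgX
    rw [hX, hgX, zero_smul, add_zero] at hX'
    exact hX' hyρ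
  have havX : avg β ρ (p j + 3 * ρ) j g X = 0 := by
    refine hav.eq_zero _ fun h1 => ?_
    have h2 := h1 j
    have h3 := hXρ j
    have h4 : (p + (3 * ρ) • ee j : Euc d) j = p j + 3 * ρ := by simp
    rw [h4] at h2
    rw [abs_le] at h2 h3
    linarith
  have h1 := hΘX X
  rw [hSj, havX, hgX, hX, neg_zero, add_zero, neg_smul, add_neg_cancel_right] at h1
  rw [h1]
  simp only [PiLp.add_apply, PiLp.smul_apply, ee_self, ee_of_ne hij, smul_eq_mul, mul_one, mul_zero,
    add_zero, hmh y hy, hh]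
  field_simp
  ring

theorem exists_localRep_of_partial (hij : i ≠ j) (hU : IsOpen U) (hp : p ∈ U)
    (hu : ContDiff ℝ (⊤ : ℕ∞) u) (ha : a ≠ 0) (hfd : ∀ v, fderiv ℝ u p v = a * v i) :
    ∃ q ∈ U, ∃ V ∈ nhds q, LocalRep U u V := by
  obtain ⟨Θ, c, hΘ, hev⟩ := exists_straightening hij hU hp hu ha hfd
  obtain ⟨Ψ, hΨ, hl, hr⟩ := IsVolDiffeo.exists_inverse hΘ
  have hq : Θ p ∈ U := by
    by_contra h
    obtain ⟨K, -, hK, h1⟩ := hΘ.2.2.2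
    have h2 := h1 _ fun h2 => h (hK h2)
    have h3 : Θ p = p := hl.injective h2
    exact h (h3.symm ▸ hp)
  have hev' : ∀ᶠ y in nhds (Θ p), u (Ψ y) = a * y i + c := by
    have h1 : Filter.Tendsto Ψ (nhds (Θ p)) (nhds p) := by
      have := hΨ.1.continuous.tendsto (Θ p)
      rwa [hl p] at this
    filter_upwards [h1.eventually hev] with y hy
    rw [hy, hr y]
  obtain ⟨W, hW, hWo, hpW⟩ := mem_nhds_iff.1 (Filter.inter_mem hev' (hU.mem_nhds hq))
  obtain ⟨ρ, hρ, hcube⟩ := exists_cube_subset hWo hpW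
  have h12 : 12 * (ρ / 12) = ρ := by ring
  refine ⟨Θ p, hq, cube (Θ p) (ρ / 12), cube_mem_nhds (by positivity),
    LocalRep.of_comp hΨ (localRep_of_affine (a := a) (c := c) hij (by positivity) ?_ ha ?_)⟩
  · rw [h12]; exact fun x hx => (hW (hcube hx)).2
  · rw [h12]; exact fun x hx => (hW (hcube hx)).1

end Local

/-! ### Isometries and translations -/

section Isometry

variable {d : ℕ} {U V : Set (Euc d)} {u f : Euc d → ℝ} {N : ℕ}

theorem IsVolDiffeo.conj (R : Euc d ≃ₗᵢ[ℝ] Euc d) {Φ : Euc d → Euc d}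
    (h : IsVolDiffeoSuppIn d (R ⁻¹' U) Φ) :
    IsVolDiffeoSuppIn d U (fun x => R (Φ (R.symm x))) := by
  obtain ⟨h1, ⟨Ψ, h2, h3, h4⟩, h5, K, h6, h7, h8⟩ := h
  refine ⟨R.contDiff.comp (h1.comp R.symm.contDiff), ⟨fun x => R (Ψ (R.symm x)),
    R.contDiff.comp (h2.comp R.symm.contDiff), fun x => by simp [h3 _], fun x => by simp [h4 _]⟩,
    R.measurePreserving.comp (h5.comp R.symm.measurePreserving), R '' K,
    h6.image R.continuous, Set.image_subset_iff.2 h7, fun x hx => ?_⟩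
  refine (congrArg R (h8 _ ?_)).trans (R.apply_symm_apply x)
  exact fun hm => hx ⟨_, hm, R.apply_symm_apply x⟩

theorem Rep.of_isometry (R : Euc d ≃ₗᵢ[ℝ] Euc d)
    (h : Rep (R ⁻¹' U) (fun x => u (R x)) N (fun x => f (R x))) : Rep U u N f := by
  obtain ⟨Φp, Φm, h1, h2, h3⟩ := h
  refine ⟨fun i x => R (Φp i (R.symm x)), fun i x => R (Φm i (R.symm x)),
    fun i => IsVolDiffeo.conj R (h1 i), fun i => IsVolDiffeo.conj R (h2 i), funext fun x => ?_⟩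
  simpa using congrFun h3 (R.symm x)

theorem LocalRep.of_isometry (R : Euc d ≃ₗᵢ[ℝ] Euc d)
    (h : LocalRep (R ⁻¹' U) (fun x => u (R x)) (R ⁻¹' V)) : LocalRep U u V := by
  refine fun A => (h A).imp fun N hN f hf hA h0 => Rep.of_isometry R ?_
  refine hN _ ⟨hf.smooth.comp R.contDiff, fun x hx => hf.eq_zero _ hx⟩ (fun x => hA _) ?_
  rw [← h0]
  exact R.measurePreserving.integral_comp R.toHomeomorph.measurableEmbedding f

theorem exists_isometry (i : Fin d) {w : Euc d} (hw : ‖w‖ = 1) :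
    ∃ R : Euc d ≃ₗᵢ[ℝ] Euc d, R (ee i) = w := by
  obtain ⟨b, hb⟩ := Orthonormal.exists_orthonormalBasis_extension_of_card_eq (𝕜 := ℝ)
    (E := Euc d) (ι := Fin d) (by simp) (v := fun _ => w) (s := {i}) (by
      rw [orthonormal_iff_ite]
      rintro ⟨k, hk⟩ ⟨l, hl⟩
      obtain rfl := Set.mem_singleton_iff.1 hk
      obtain rfl := Set.mem_singleton_iff.1 hl
      simp [hw])
  refine ⟨b.repr.symm, ?_⟩
  rw [← hb i rfl]
  exact b.repr_symm_single i

theorem exists_localRep {i j : Fin d} (hij : i ≠ j) (hu : ContDiff ℝ (⊤ : ℕ∞) u)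
    (hne : ∃ x ∈ Metric.ball (0 : Euc d) 1, ∃ y ∈ Metric.ball (0 : Euc d) 1, u x ≠ u y) :
    ∃ q ∈ Metric.ball (0 : Euc d) 1, ∃ V ∈ nhds q, LocalRep (Metric.ball 0 1) u V := by
  obtain ⟨p, hp, hfp⟩ : ∃ p ∈ Metric.ball (0 : Euc d) 1, fderiv ℝ u p ≠ 0 := by
    by_contra! h0
    obtain ⟨x, hx, y, hy, hxy⟩ := hne
    have := (convex_ball (0 : Euc d) 1).norm_image_sub_le_of_norm_fderiv_le (C := 0)
      (fun y _ => hu.differentiable (by simp) y) (fun y hy => by rw [h0 y hy, norm_zero]) hy hx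
    rw [zero_mul, norm_le_zero_iff, sub_eq_zero] at this
    exact hxy this
  set w : Euc d := (InnerProductSpace.toDual ℝ (Euc d)).symm (fderiv ℝ u p) with hw
  have hw0 : w ≠ 0 := by simpa [hw] using hfp
  have hwv : ∀ v, fderiv ℝ u p v = inner ℝ w v := fun v => by
    rw [hw, InnerProductSpace.toDual_symm_apply]
  obtain ⟨R, hR⟩ := exists_isometry i (w := ‖w‖⁻¹ • w) (norm_smul_inv_norm hw0)
  have hball : R ⁻¹' Metric.ball 0 1 = Metric.ball (0 : Euc d) 1 := by
    ext x
    simp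
  obtain ⟨q, hq, V, hV, h⟩ := exists_localRep_of_partial (U := Metric.ball (0 : Euc d) 1)
    (p := R.symm p) (u := fun x => u (R x)) (a := ‖w‖) hij Metric.isOpen_ball
    (by simpa using hp) (hu.comp R.contDiff) (norm_ne_zero_iff.2 hw0) fun v => by
      have h1 : HasFDerivAt (fun x => u (R x)) _ (R.symm p) :=
        HasFDerivAt.comp (R.symm p) (g := u) (f := R)
          ((hu.differentiable (by simp) (R (R.symm p))).hasFDerivAt)
          (R : Euc d ≃L[ℝ] Euc d).hasFDerivAt
      rw [h1.fderiv, R.apply_symm_apply]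
      change fderiv ℝ u p (R v) = _
      have h2 : w = ‖w‖ • R (ee i) := by
        rw [hR, smul_smul, mul_inv_cancel₀ (norm_ne_zero_iff.2 hw0), one_smul]
      rw [hwv, h2, real_inner_smul_left, R.inner_map_map, ← h2, ee,
        EuclideanSpace.inner_single_left]
      simp
  refine ⟨R q, by simpa using hq, R '' V, R.toHomeomorph.isOpenMap.image_mem_nhds hV,
    LocalRep.of_isometry R ?_⟩
  rwa [hball, Set.preimage_image_eq _ R.injective]

end Isometry

section Translation

variable {d : ℕ} {K : Set (Euc d)} {u f : Euc d → ℝ} {N : ℕ} {i j : Fin d}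

theorem exists_functional (hij : i ≠ j) (v : Euc d) :
    ∃ (ℓ : Euc d →L[ℝ] ℝ) (b : Euc d), ℓ v = 0 ∧ ℓ b = 1 := by
  by_cases h : v i = 0
  · exact ⟨EuclideanSpace.proj i, ee i, h, ee_self i⟩
  · refine ⟨(EuclideanSpace.proj j : Euc d →L[ℝ] ℝ) - (v j / v i) • EuclideanSpace.proj i, ee j,
      ?_, ?_⟩
    · change v j - v j / v i * v i = 0
      field_simp
      ring
    · change (ee j : Euc d) j - v j / v i * (ee j : Euc d) i = 1
      rw [ee_self, ee_of_ne hij]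
      ring

theorem exists_translation_closedBall (hij : i ≠ j) {r : ℝ} (hr : r < 1) (v : Euc d) :
    ∃ Φ, IsVolDiffeoSuppIn d (Metric.ball 0 1) Φ ∧
      ∀ x ∈ Metric.closedBall (0 : Euc d) r, x - v ∈ Metric.closedBall (0 : Euc d) r →
        Φ x = x - v := by
  obtain ⟨ℓ, b, hv, hb⟩ := exists_functional hij v
  obtain ⟨r₁, hr₁, hr₁'⟩ := exists_between hr
  obtain ⟨r₂, hr₂, hr₂'⟩ := exists_between hr₁'
  obtain ⟨ψ, hψ, hψ1, -⟩ := exists_cutoff (d := d) (K := Metric.closedBall 0 r₁)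
    (V := Metric.ball 0 r₂) Metric.isClosed_closedBall Metric.isOpen_ball
    (Metric.closedBall_subset_ball hr₂)
  have hS : SmoothIn (Metric.closedBall 0 r₂) (fun x => ℓ x * ψ x) :=
    ⟨ℓ.contDiff.mul hψ.smooth, fun x hx => by
      rw [hψ.eq_zero x fun h => hx (Metric.ball_subset_closedBall h), mul_zero]⟩
  have hSb := hS.pd Metric.isClosed_closedBall b
  obtain ⟨L, hL0, hL⟩ := (hSb.pd Metric.isClosed_closedBall v).exists_bound
    (isCompact_closedBall _ _)
  obtain ⟨k, hk⟩ := exists_nat_ge (2 * L)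
  set ε : ℝ := 1 / (k + 1 : ℕ) with hε
  have hε0 : 0 < ε := by positivity
  have hpd : ∀ w, pd (fun x => ε * (ℓ x * ψ x)) w = fun x => ε * pd (fun x => ℓ x * ψ x) w x :=
    fun w => funext fun x => by
      rw [pd, fderiv_const_mul (hS.smooth.differentiable (by simp) x)]
      rfl
  have hSL : DirLip (1 / 2) v (pd (fun x => ε * (ℓ x * ψ x)) b) := by
    rw [hpd]
    refine ((dirLip_of_fderiv_le hSb.smooth hL).const_mul ε).mono ?_
    rw [abs_of_pos hε0, hε, one_div_mul_eq_div, div_le_iff₀ (by positivity)]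
    push_cast
    linarith
  obtain ⟨Φ, hΦ, hΦX⟩ := exists_generated (isCompact_closedBall (0 : Euc d) r₂)
    (Metric.closedBall_subset_ball hr₂') (contDiff_const.mul hS.smooth)
    (fun x hx => by rw [hS.eq_zero x hx, mul_zero]) hSL
  have hstep : ∀ X ∈ Metric.closedBall (0 : Euc d) r, Φ (X + ε • v) = X := fun X hX => by
    have hev : (fun x => ℓ x * ψ x) =ᶠ[nhds X] ℓ := by
      filter_upwards [Metric.isOpen_ball.mem_nhds (Metric.closedBall_subset_ball hr₁ hX)] with y hy
      rw [hψ1 y (Metric.ball_subset_closedBall hy), mul_one]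
    have h1 : ∀ w, pd (fun x => ℓ x * ψ x) w X = ℓ w := fun w => by
      rw [pd, hev.fderiv_eq, ℓ.fderiv]
    have h2 := hΦX X
    rw [hpd, hpd] at h2
    simpa [h1, hv, hb] using h2
  refine ⟨Φ^[k + 1], IsVolDiffeo.iterate hΦ _, fun x hx hxv => ?_⟩
  have key : ∀ m ≤ k + 1, Φ^[m] x = x - (m * ε) • v := fun m hm => by
    induction m with
    | zero => simp
    | succ m ih =>
      rw [Function.iterate_succ_apply', ih (by omega)]
      have h1 : x - (m * ε) • v = x - ((m + 1 : ℕ) * ε) • v + ε • v := by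
        push_cast
        module
      rw [h1]
      refine hstep _ ?_
      have h2 : ((m + 1 : ℕ) : ℝ) * ε ≤ 1 := by
        rw [hε, mul_one_div, div_le_one (by positivity)]
        exact_mod_cast hm
      have h3 := (convex_closedBall (0 : Euc d) r) hx hxv (sub_nonneg.2 h2)
        (by positivity : (0 : ℝ) ≤ (m + 1 : ℕ) * ε) (by ring)
      convert h3 using 1
      module
  rw [key _ le_rfl, hε, mul_one_div, div_self (by positivity), one_smul]

theorem exists_translation (hij : i ≠ j) (hK : IsCompact K) (hKB : K ⊆ Metric.ball 0 1) {v : Euc d}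
    (hv : ∀ x ∈ K, x - v ∈ Metric.ball (0 : Euc d) 1) :
    ∃ Φ, IsVolDiffeoSuppIn d (Metric.ball 0 1) Φ ∧ ∀ x ∈ K, Φ x = x - v := by
  have hK' : IsCompact ((fun x => x - v) '' K) := hK.image (by fun_prop)
  obtain ⟨r, hr, hKr⟩ := exists_lt_subset_ball (hK.union hK').isClosed
    (Set.union_subset hKB (Set.image_subset_iff.2 hv))
  obtain ⟨Φ, hΦ, h⟩ := exists_translation_closedBall hij hr v
  exact ⟨Φ, hΦ, fun x hx => h x (Metric.ball_subset_closedBall (hKr (Or.inl hx)))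
    (Metric.ball_subset_closedBall (hKr (Or.inr ⟨x, hx, rfl⟩)))⟩

theorem Rep.of_translate (hij : i ≠ j) (hK : IsCompact K) (hKB : K ⊆ Metric.ball 0 1) {v : Euc d}
    (hv : ∀ x ∈ K, x - v ∈ Metric.ball (0 : Euc d) 1) (hf : ∀ x ∉ K, f x = 0)
    (h : Rep (Metric.ball 0 1) u N (fun x => f (x + v))) : Rep (Metric.ball 0 1) u N f := by
  obtain ⟨Φ, hΦ, hΦK⟩ := exists_translation hij hK hKB hv
  convert h.comp hΦ using 2 with x
  by_cases hx : x ∈ K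
  · rw [hΦK x hx, sub_add_cancel]
  · rw [hf x hx, hf]
    intro hy
    have h1 := hΦK _ hy
    rw [add_sub_cancel_right] at h1
    obtain ⟨Ψ, -, hΨ, -⟩ := hΦ.2.1
    exact hx (hΨ.injective h1 ▸ hy)

end Translation

/-! ### From local to global -/

section Global

variable {d : ℕ} {K V : Set (Euc d)} {u e : Euc d → ℝ} {i j : Fin d} {v : Euc d}

theorem SmoothIn.integrable {g : Euc d → ℝ} (h : SmoothIn K g) (hK : IsCompact K) :
    Integrable g :=
  h.smooth.continuous.integrable_of_hasCompactSupport (h.hasCompactSupport hK)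

theorem SmoothIn.abs_integral_le {g : Euc d → ℝ} {A : ℝ} (h : SmoothIn K g)
    (hKB : K ⊆ Metric.ball 0 1) (hA : ∀ x, |g x| ≤ A) :
    |∫ x, g x| ≤ A * volume.real (Metric.ball (0 : Euc d) 1) := by
  rw [← setIntegral_eq_integral_of_forall_compl_eq_zero (s := Metric.ball (0 : Euc d) 1)
    fun x hx => h.eq_zero x fun hx' => hx (hKB hx')]
  exact norm_setIntegral_le_of_norm_le_const (f := g)
    Metric.isBounded_ball.measure_lt_top fun x _ => hA x

theorem SmoothIn.translate (h : SmoothIn K e) (w : Euc d) :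
    SmoothIn ((fun x => x + w) '' K) (fun x => e (x - w)) :=
  ⟨h.smooth.comp (by fun_prop), fun x hx => h.eq_zero _ fun hm => hx ⟨_, hm, sub_add_cancel x w⟩⟩

theorem add_smul_mem_ball {x : Euc d} (hx : x ∈ Metric.ball (0 : Euc d) 1)
    (hxv : x + v ∈ Metric.ball (0 : Euc d) 1) {t : ℝ} (ht0 : 0 ≤ t) (ht1 : t ≤ 1) :
    x + t • v ∈ Metric.ball (0 : Euc d) 1 := by
  convert (convex_ball (0 : Euc d) 1) hx hxv (sub_nonneg.2 ht1) ht0 (by ring) using 1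
  module

theorem exists_rep_translate_sub (hij : i ≠ j) (hloc : LocalRep (Metric.ball 0 1) u V)
    (hV : IsOpen V) (he : SmoothIn K e) (hK : IsCompact K) (hKV : K ⊆ V)
    (hKB : K ⊆ Metric.ball 0 1) (hv : ∀ x ∈ K, x + v ∈ Metric.ball (0 : Euc d) 1) (A : ℝ) :
    ∃ N, ∀ μ : ℝ, |μ| ≤ A → Rep (Metric.ball 0 1) u N (fun x => μ * (e (x - v) - e x)) := by
  obtain ⟨δ, hδ, hδV⟩ := hK.exists_thickening_subset_open hV hKV
  obtain ⟨M, hM⟩ := exists_nat_gt (‖v‖ / δ)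
  set τ : ℝ := 1 / (M + 1 : ℕ) with hτ
  have hτ0 : 0 < τ := by positivity
  have hτM : ∀ k < M + 1, ((k + 1 : ℕ) : ℝ) * τ ≤ 1 := fun k hk => by
    rw [hτ, mul_one_div, div_le_one (by positivity)]
    exact_mod_cast hk
  have hwV : ∀ x ∈ K, x + τ • v ∈ V := fun x hx => hδV <| by
    refine Metric.mem_thickening_iff.2 ⟨x, hx, ?_⟩
    rw [dist_eq_norm, add_sub_cancel_left, norm_smul, Real.norm_of_nonneg hτ0.le, hτ,
      one_div_mul_eq_div, div_lt_iff₀ (by positivity)]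
    rw [div_lt_iff₀ hδ] at hM
    push_cast
    linarith
  obtain ⟨D, hD0, hD⟩ := he.exists_bound hK
  obtain ⟨N, hN⟩ := hloc (A * (2 * D))
  refine ⟨∑ _k ∈ Finset.range (M + 1), N, fun μ hμ => ?_⟩
  have het := he.translate (τ • v)
  have hKt : IsCompact ((fun x => x + τ • v) '' K) := hK.image (by fun_prop)
  have hF : Rep (Metric.ball 0 1) u N (fun x => μ * (e (x - τ • v) - e x)) := by
    refine hN _ ⟨contDiff_const.mul (het.smooth.sub he.smooth), fun x hx => ?_⟩ (fun x => ?_) ?_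
    · rw [het.eq_zero, he.eq_zero, sub_zero, mul_zero]
      · exact fun h => hx (hKV h)
      · rintro ⟨y, hy, rfl⟩
        exact hx (hwV y hy)
    · rw [abs_mul]
      have h1 := hD (x - τ • v)
      have h2 := hD x
      rw [Real.norm_eq_abs, abs_le] at h1 h2
      refine mul_le_mul hμ ?_ (abs_nonneg _) ((abs_nonneg _).trans hμ)
      rw [abs_le]
      constructor <;> linarith
    · rw [integral_const_mul, integral_sub (het.integrable hKt) (he.integrable hK),
        integral_sub_right_eq_self, sub_self, mul_zero]
  have hterm : ∀ k ∈ Finset.range (M + 1), Rep (Metric.ball 0 1) u N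
      (fun x => μ * e (x - (((k + 1 : ℕ) : ℝ) * τ) • v) - μ * e (x - ((k : ℝ) * τ) • v)) := by
    intro k hk
    have hk1 := hτM k (Finset.mem_range.1 hk)
    have hk0 : (k : ℝ) * τ ≤ 1 := le_trans (by gcongr; simp) hk1
    refine Rep.of_translate hij (v := ((k : ℝ) * τ) • v)
      (K := (fun x => x + (((k + 1 : ℕ) : ℝ) * τ) • v) '' K ∪ (fun x => x + ((k : ℝ) * τ) • v) '' K)
      ((hK.image (by fun_prop)).union (hK.image (by fun_prop))) ?_ ?_ (fun x hx => ?_) ?_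
    · rintro _ (⟨x, hx, rfl⟩ | ⟨x, hx, rfl⟩)
      · exact add_smul_mem_ball (hKB hx) (hv x hx) (by positivity) hk1
      · exact add_smul_mem_ball (hKB hx) (hv x hx) (by positivity) hk0
    · rintro _ (⟨x, hx, rfl⟩ | ⟨x, hx, rfl⟩)
      · have h1 : x + (((k + 1 : ℕ) : ℝ) * τ) • v - ((k : ℝ) * τ) • v = x + τ • v := by
          push_cast
          module
        change x + (((k + 1 : ℕ) : ℝ) * τ) • v - ((k : ℝ) * τ) • v ∈ _
        rw [h1]
        refine add_smul_mem_ball (hKB hx) (hv x hx) hτ0.le (le_trans ?_ hk1)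
        push_cast
        nlinarith [mul_nonneg (Nat.cast_nonneg (α := ℝ) k) hτ0.le]
      · change x + ((k : ℝ) * τ) • v - ((k : ℝ) * τ) • v ∈ _
        rw [add_sub_cancel_right]
        exact hKB hx
    · rw [Set.mem_union, not_or] at hx
      rw [(he.translate _).eq_zero x hx.1, (he.translate _).eq_zero x hx.2, mul_zero, sub_zero]
    · convert hF using 2 with x
      rw [add_sub_cancel_right, show x + ((k : ℝ) * τ) • v - (((k + 1 : ℕ) : ℝ) * τ) • v
        = x - τ • v by push_cast; module]
      ring
  convert Rep.sum (Finset.range (M + 1)) hterm using 2 with x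
  rw [Finset.sum_range_sub (fun k : ℕ => μ * e (x - ((k : ℝ) * τ) • v)), hτ, mul_one_div,
    div_self (by positivity)]
  simp
  ring

theorem exists_rep_sub_integral (hij : i ≠ j) (hloc : LocalRep (Metric.ball 0 1) u V)
    (hV : IsOpen V) (hVB : V ⊆ Metric.ball 0 1) (he : SmoothIn K e) (hK : IsCompact K)
    (hKV : K ⊆ V) (he1 : ∫ x, e x = 1) (hv : ∀ x ∈ K, x + v ∈ Metric.ball (0 : Euc d) 1) (A : ℝ) :
    ∃ N, ∀ (g : Euc d → ℝ) (L : Set (Euc d)), IsCompact L → L ⊆ Metric.ball 0 1 →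
      (∀ x ∈ L, x - v ∈ V) → SmoothIn L g → (∀ x, |g x| ≤ A) →
      Rep (Metric.ball 0 1) u N (fun x => g x - (∫ y, g y) * e x) := by
  obtain ⟨D, hD0, hD⟩ := he.exists_bound hK
  set I := A * volume.real (Metric.ball (0 : Euc d) 1) with hI
  obtain ⟨N, hN⟩ := hloc (A + I * D)
  obtain ⟨M, hM⟩ := exists_rep_translate_sub hij hloc hV he hK hKV (hKV.trans hVB) hv I
  refine ⟨N + M, fun g L hL hLB hLV hg hA => ?_⟩
  have hgI := hg.abs_integral_le hLB hA
  have hKt : IsCompact ((fun x => x + v) '' K) := hK.image (by fun_prop)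
  have h1 : Rep (Metric.ball 0 1) u N (fun x => g x - (∫ y, g y) * e (x - v)) := by
    refine Rep.of_translate hij (v := v) (hL.union hKt)
      (Set.union_subset hLB (Set.image_subset_iff.2 hv)) ?_ (fun x hx => ?_) ?_
    · rintro _ (hx | ⟨x, hx, rfl⟩)
      · exact hVB (hLV _ hx)
      · change x + v - v ∈ _
        rw [add_sub_cancel_right]
        exact hVB (hKV hx)
    · rw [Set.mem_union, not_or] at hx
      rw [hg.eq_zero x hx.1, (he.translate v).eq_zero x hx.2, mul_zero, sub_zero]
    · simp only [add_sub_cancel_right]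
      refine hN _ ⟨(hg.smooth.comp (by fun_prop)).sub (contDiff_const.mul he.smooth),
        fun x hx => ?_⟩ (fun x => ?_) ?_
      · rw [he.eq_zero x fun h => hx (hKV h), hg.eq_zero, mul_zero, sub_zero]
        intro h
        have := hLV _ h
        rw [add_sub_cancel_right] at this
        exact hx this
      · refine (abs_sub _ _).trans ?_
        rw [abs_mul]
        have h2 := hA (x + v)
        have h3 : |∫ y, g y| * |e x| ≤ I * D := by
          gcongr
          · exact (abs_nonneg _).trans hgI
          · exact hD x
        linarith
      · rw [integral_sub ((hg.integrable hL).comp_add_right v)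
          ((he.integrable hK).const_mul _), integral_const_mul, he1,
          integral_add_right_eq_self g v, mul_one, sub_self]
  convert h1.add (hM _ hgI) using 2 with x
  ring

theorem exists_rep_of_localRep (hij : i ≠ j) {q : Euc d} (hq : q ∈ Metric.ball (0 : Euc d) 1)
    (hV : V ∈ nhds q) (hloc : LocalRep (Metric.ball 0 1) u V) :
    ∃ N, ∀ (f : Euc d → ℝ) (K : Set (Euc d)), IsCompact K → K ⊆ Metric.ball 0 1 → SmoothIn K f →
      (∀ x, |f x| ≤ 1) → ∫ x, f x = 0 → Rep (Metric.ball 0 1) u N f := by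
  obtain ⟨ρ', hρ', hball⟩ := Metric.mem_nhds_iff.1
    (Filter.inter_mem hV (Metric.isOpen_ball.mem_nhds hq))
  set ρ := min ρ' 1 with hρ
  have hρ0 : 0 < ρ := by positivity
  have hρ1 : ρ ≤ 1 := min_le_right _ _
  have hsub : Metric.ball q ρ ⊆ V ∩ Metric.ball 0 1 :=
    (Metric.ball_subset_ball (min_le_left _ _)).trans hball
  replace hloc : LocalRep (Metric.ball 0 1) u (Metric.ball q ρ) := hloc.mono fun x hx => (hsub hx).1
  have hVB : Metric.ball q ρ ⊆ Metric.ball 0 1 := fun x hx => (hsub hx).2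
  let φ : ContDiffBump q := ⟨ρ / 8, ρ / 4, by positivity, by linarith⟩
  set e : Euc d → ℝ := φ.normed volume with he
  have hes : SmoothIn (Metric.closedBall q (ρ / 4)) e := by
    refine ⟨φ.contDiff_normed, fun x hx => ?_⟩
    rw [← Function.notMem_support, he, φ.support_normed_eq]
    exact fun h => hx (Metric.ball_subset_closedBall h)
  have hKV : Metric.closedBall q (ρ / 4) ⊆ Metric.ball q ρ :=
    Metric.closedBall_subset_ball (by linarith)
  have hcent : ∀ c ∈ Metric.closedBall (0 : Euc d) (1 - ρ / 2),
      ∃ N, ∀ (g : Euc d → ℝ) (L : Set (Euc d)), IsCompact L → L ⊆ Metric.ball 0 1 →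
        L ⊆ Metric.ball c ρ → SmoothIn L g → (∀ x, |g x| ≤ 1) →
        Rep (Metric.ball 0 1) u N (fun x => g x - (∫ y, g y) * e x) := by
    intro c hc
    obtain ⟨N, hN⟩ := exists_rep_sub_integral hij hloc Metric.isOpen_ball hVB hes
      (isCompact_closedBall _ _) hKV φ.integral_normed (v := c - q) (fun x hx => by
        rw [mem_ball_zero_iff]
        rw [mem_closedBall_zero_iff] at hc
        rw [mem_closedBall_iff_norm] at hx
        calc ‖x + (c - q)‖ = ‖(x - q) + c‖ := by congr 1; abel
          _ ≤ ‖x - q‖ + ‖c‖ := norm_add_le _ _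
          _ < 1 := by linarith) 1
    refine ⟨N, fun g L hL hLB hLc hg hA => hN g L hL hLB (fun x hx => ?_) hg hA⟩
    have := hLc hx
    rw [mem_ball_iff_norm] at this ⊢
    rwa [show x - (c - q) - q = x - c by abel]
  choose! n hn using hcent
  obtain ⟨t, hcover⟩ := (isCompact_closedBall (0 : Euc d) 1).elim_nhds_subcover'
    (fun x _ => Metric.ball ((1 - ρ / 2) • x) ρ) fun x hx => by
      refine Metric.isOpen_ball.mem_nhds ?_
      rw [mem_closedBall_zero_iff] at hx
      rw [mem_ball_iff_norm, show x - (1 - ρ / 2) • x = (ρ / 2) • x by module, norm_smul,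
        Real.norm_of_nonneg (by positivity)]
      nlinarith
  obtain ⟨κ, hκ⟩ := SmoothPartitionOfUnity.exists_isSubordinate
    (modelWithCornersSelf ℝ (Euc d)) (Metric.isClosed_closedBall (x := (0 : Euc d)) (ε := 1))
    (fun i : t => Metric.ball ((1 - ρ / 2) • ((i : Metric.closedBall (0 : Euc d) 1) : Euc d)) ρ)
    (fun _ => Metric.isOpen_ball) fun x hx => by
      obtain ⟨i, hi, hxi⟩ := Set.mem_iUnion₂.1 (hcover hx)
      exact Set.mem_iUnion.2 ⟨⟨i, hi⟩, hxi⟩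
  have hc : ∀ x ∈ Metric.closedBall (0 : Euc d) 1,
      (1 - ρ / 2) • x ∈ Metric.closedBall (0 : Euc d) (1 - ρ / 2) := fun x hx => by
    rw [mem_closedBall_zero_iff] at hx ⊢
    rw [norm_smul, Real.norm_of_nonneg (by linarith)]
    nlinarith
  refine ⟨∑ i : t, n ((1 - ρ / 2) • (i : Metric.closedBall (0 : Euc d) 1)),
    fun f K hK hKB hf hA h0 => ?_⟩
  have hg : ∀ i, SmoothIn (K ∩ tsupport (κ i)) (fun x => κ i x * f x) := fun i =>
    ⟨(κ i).contMDiff.contDiff.mul hf.smooth, fun x hx => by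
      by_cases h : x ∈ K
      · rw [image_eq_zero_of_notMem_tsupport fun h' => hx ⟨h, h'⟩, zero_mul]
      · rw [hf.eq_zero x h, mul_zero]⟩
  have hcomp : ∀ i, IsCompact (K ∩ tsupport (κ i)) := fun i => hK.inter_right (isClosed_tsupport _)
  have hsum : ∀ x, ∑ i, κ i x * f x = f x := fun x => by
    by_cases h : x ∈ K
    · rw [← Finset.sum_mul, ← finsum_eq_sum_of_fintype,
        κ.sum_eq_one (Metric.ball_subset_closedBall (hKB h)), one_mul]
    · simp [hf.eq_zero x h]
  have hterm := Rep.sum Finset.univ fun (i : t) _ =>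
    hn _ (hc i i.1.2) _ _ (hcomp i) (Set.inter_subset_left.trans hKB)
      (Set.inter_subset_right.trans (hκ i)) (hg i) fun x => by
        rw [abs_mul, abs_of_nonneg (κ.nonneg i x)]
        exact mul_le_one₀ (κ.le_one i x) (abs_nonneg _) (hA x)
  convert hterm using 2 with x
  rw [Finset.sum_sub_distrib, hsum, ← Finset.sum_mul,
    ← integral_finsetSum _ fun i _ => (hg i).integrable (hcomp i)]
  simp_rw [hsum, h0, zero_mul, sub_zero]

end Global

end VolFlex

/-- **Finite-volume corollary for the open unit ball `B ⊂ ℝ^{2n}`.** If `u` is smooth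
and non-constant on `B`, there is `C = C(u) > 0` such that every smooth `f` with
compact support contained in `B`, zero mean and `‖f‖_∞ ≤ 1` can be written as
`∑_{i=1}^N (u ∘ Φ_{i,+} − u ∘ Φ_{i,-})` with `N ≤ C` and the `Φ_{i,±}` measure
preserving diffeomorphisms equal to the identity outside compact subsets of `B`. -/
theorem flexibility_finite_volume (n : ℕ) (hn : 1 ≤ n)
    (u : EuclideanSpace ℝ (Fin (2 * n)) → ℝ)
    (hu_smooth : ContDiff ℝ (⊤ : ℕ∞) u)
    (hu_nonconst : ∃ x ∈ Metric.ball (0 : EuclideanSpace ℝ (Fin (2 * n))) 1,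
      ∃ y ∈ Metric.ball (0 : EuclideanSpace ℝ (Fin (2 * n))) 1, u x ≠ u y) :
    ∃ C : ℝ, 0 < C ∧
      ∀ f : EuclideanSpace ℝ (Fin (2 * n)) → ℝ,
        ContDiff ℝ (⊤ : ℕ∞) f →
        IsCompact (tsupport f) →
        tsupport f ⊆ Metric.ball (0 : EuclideanSpace ℝ (Fin (2 * n))) 1 →
        (∫ x, f x) = 0 →
        (⨆ x, |f x|) ≤ 1 →
        ∃ N : ℕ, (N : ℝ) ≤ C ∧
          ∃ Φp Φm : Fin N → (EuclideanSpace ℝ (Fin (2 * n)) → EuclideanSpace ℝ (Fin (2 * n))),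
            (∀ i, IsVolDiffeoSuppIn (2 * n)
              (Metric.ball (0 : EuclideanSpace ℝ (Fin (2 * n))) 1) (Φp i)) ∧
            (∀ i, IsVolDiffeoSuppIn (2 * n)
              (Metric.ball (0 : EuclideanSpace ℝ (Fin (2 * n))) 1) (Φm i)) ∧
            f = fun x => ∑ i, (u (Φp i x) - u (Φm i x)) := by
  have h0 : 0 < 2 * n := by omega
  have h1 : 1 < 2 * n := by omega
  have hij : (⟨0, h0⟩ : Fin (2 * n)) ≠ ⟨1, h1⟩ := by simp
  obtain ⟨q, hq, V, hV, hloc⟩ := VolFlex.exists_localRep hij hu_smooth hu_nonconst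
  obtain ⟨N, hN⟩ := VolFlex.exists_rep_of_localRep hij hq hV hloc
  refine ⟨N + 1, by positivity, fun f hf hK hKB hfint hsup => ⟨N, by simp, ?_⟩⟩
  have hfs : VolFlex.SmoothIn (tsupport f) f :=
    ⟨hf, fun x hx => image_eq_zero_of_notMem_tsupport hx⟩
  obtain ⟨D, -, hD⟩ := hfs.exists_bound hK
  have hbdd : BddAbove (Set.range fun x => |f x|) := ⟨D, by rintro _ ⟨x, rfl⟩; exact hD x⟩
  exact hN f _ hK hKB hfs (fun x => (le_ciSup hbdd x).trans hsup) hfint
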